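/- Let a local stabilizer code on Λ = (ℤ/Lℤ)^D satisfy the topological order conditions at scale L_tqo and obey the no-strings rule with constant α ≥ 1. Let E₁,…,E_T be an error path with syndrome history {S(t)}, let m = max_t |S(t)|, and let p ≥ 0 satisfy 4m(2 + ξ(p)) < L_tqo. Then for every consecutive pair S′, S″ of the level-p syndrome history, with E the level-p error connecting them, there exists a Pauli operator Ẽ supported on B_{ξ(p)}(S′ ∪ S″) such that E·Ẽ ∈ 𝒢. -/

import Mathlib

open Finset

namespace BH

/-- The lattice `Λ = (ℤ/Lℤ)^D`. -/
abbrev Site (L D : ℕ) := Fin D → ZMod L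

/-- Pauli operators modulo phase on a set `Q` of qubits, written additively:
`E = (Eˣ, Eᶻ)` componentwise over `𝔽₂ × 𝔽₂`. -/
abbrev Pauli (Q : Type) := Q → ZMod 2 × ZMod 2

/-- A single-qubit Pauli operator: one supported on a single qubit. -/
def singleQubit {Q : Type} (E : Pauli Q) : Prop :=
  ∃ q, ∀ q', E q' ≠ 0 → q' = q

/-- The weight of a Pauli operator: the cardinality of its support. -/
noncomputable def pweight {Q : Type} [Fintype Q] (E : Pauli Q) : ℕ :=
  (Finset.univ.filter fun q => E q ≠ 0).card

/-- The symplectic form `ω(E,F) = Σ_q (Eˣ_q Fᶻ_q + Eᶻ_q Fˣ_q)`;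
`E` and `F` commute iff `ω(E,F) = 0`. -/
def sympForm {Q : Type} [Fintype Q] (E F : Pauli Q) : ZMod 2 :=
  ∑ q, ((E q).1 * (F q).2 + (E q).2 * (F q).1)

/-- Partial product (= sum, in additive notation) `E_t ⋯ E_2 E_1` of the
first `t` errors of an error path. -/
def partialSum {Q : Type} {T : ℕ} (Ep : Fin T → Pauli Q) (t : ℕ) : Pauli Q :=
  ∑ s : Fin T, if (s : ℕ) < t then Ep s else 0

/-- Distance on the cyclic group `ℤ/Lℤ` (periodic boundary conditions). -/
def cDist {L : ℕ} (a b : ZMod L) : ℕ := min (a - b).val (b - a).val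

/-- The `l_∞` distance on the lattice `(ℤ/Lℤ)^D`. -/
def dist' {L D : ℕ} (u v : Site L D) : ℕ :=
  Finset.univ.sup fun i => cDist (u i) (v i)

/-- `l_∞` diameter of a finite set of sites. -/
def fdiam {L D : ℕ} (X : Finset (Site L D)) : ℕ :=
  X.sup fun u => X.sup fun v => dist' u v

/-- `l_∞` distance between two finite sets of sites. -/
noncomputable def fdist {L D : ℕ} (X Y : Finset (Site L D)) : ℕ :=
  sInf {d | ∃ u ∈ X, ∃ v ∈ Y, dist' u v = d}

/-- `B_r(A)`: the set of points at distance at most `r` from `A`. -/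
def ball {L D : ℕ} (r : ℝ) (A : Set (Site L D)) : Set (Site L D) :=
  {v | ∃ u ∈ A, ((dist' u v : ℕ) : ℝ) ≤ r}

/-- The cube of linear size `ℓ` with corner `c`. -/
def cubeSet {L D : ℕ} (c : Site L D) (ℓ : ℝ) : Set (Site L D) :=
  {v | ∀ i, (((v i - c i).val : ℕ) : ℝ) ≤ ℓ}

/-- The elementary cube with corner `c` (a translate of `{0,1}^D`). -/
def elemCube {L D : ℕ} [NeZero L] (c : Site L D) : Finset (Site L D) :=
  Finset.univ.filter fun v => ∀ i, (v i - c i).val ≤ 1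

/-- The level-`p` unit of length `ξ(p) = (10α)^p`. -/
def ξ (α : ℝ) (p : ℕ) : ℝ := (10 * α) ^ p

/-- A local stabilizer code on `Λ = (ℤ/Lℤ)^D` with `K` qubits per site:
a family of pairwise commuting Pauli operators `G a`, each supported on the
sites of the elementary cube located at `loc a`. -/
structure Code (L D K : ℕ) [NeZero L] (A : Type) [Fintype A] where
  G : A → Pauli (Site L D × Fin K)
  loc : A → Site L D
  comm : ∀ a b, sympForm (G a) (G b) = 0
  localGen : ∀ a q, G a q ≠ 0 → q.1 ∈ elemCube (loc a)

variable {L D K : ℕ} [NeZero L] {A : Type} [Fintype A]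

/-- `E` is supported (as a set of sites) inside `X`. -/
def suppIn (E : Pauli (Site L D × Fin K)) (X : Set (Site L D)) : Prop :=
  ∀ q, E q ≠ 0 → q.1 ∈ X

/-- `E` is supported in some cube of linear size `ℓ`. -/
def smallSupp (E : Pauli (Site L D × Fin K)) (ℓ : ℝ) : Prop :=
  ∃ c, suppIn E (cubeSet c ℓ)

/-- `(c, ℓ)` is a smallest cube enclosing `X`. -/
def minEnclosing {L D : ℕ} (c : Site L D) (ℓ : ℝ) (X : Set (Site L D)) : Prop :=
  0 ≤ ℓ ∧ X ⊆ cubeSet c ℓ ∧ ∀ c' ℓ', 0 ≤ ℓ' → X ⊆ cubeSet c' ℓ' → ℓ ≤ ℓ'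

namespace Code

/-- The stabilizer group `𝒢`. -/
def stab (code : Code L D K A) : AddSubgroup (Pauli (Site L D × Fin K)) :=
  AddSubgroup.closure (Set.range code.G)

/-- The syndrome of `E`: the set of generators anticommuting with `E` (defects). -/
def syndrome (code : Code L D K A) (E : Pauli (Site L D × Fin K)) : Finset A :=
  Finset.univ.filter fun a => sympForm (code.G a) E = 1

/-- The set of lattice sites covered by the elementary cubes of a set `S` of
defects (the syndrome regarded as a set of elementary cubes). -/
def synSites (code : Code L D K A) (S : Finset A) : Finset (Site L D) :=
  S.biUnion fun a => elemCube (code.loc a)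

/-- A set of defects is neutral if it is the syndrome of some Pauli operator
supported in a cube of linear size `Ltqo`; otherwise it is charged. -/
def neutral (code : Code L D K A) (Ltqo : ℝ) (S : Finset A) : Prop :=
  ∃ E, code.syndrome E = S ∧ smallSupp E Ltqo

/-- (TQO1) Every Pauli operator with empty syndrome supported in a cube of
linear size `Ltqo` is a stabilizer. -/
def tqo1 (code : Code L D K A) (Ltqo : ℝ) : Prop :=
  ∀ E, smallSupp E Ltqo → code.syndrome E = ∅ → E ∈ code.stab

/-- (TQO2) Every neutral set `S` of defects is the syndrome of some Pauli
operator supported on `B₁(C_min(S))`. -/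
def tqo2 (code : Code L D K A) (Ltqo : ℝ) : Prop :=
  ∀ S, code.neutral Ltqo S →
    ∀ c ℓ, minEnclosing c ℓ (code.synSites S : Set (Site L D)) →
      ∃ E, code.syndrome E = S ∧ suppIn E (ball 1 (cubeSet c ℓ))

/-- The topological order conditions at scale `Ltqo`. -/
def tqo (code : Code L D K A) (Ltqo : ℝ) : Prop :=
  code.tqo1 Ltqo ∧ code.tqo2 Ltqo

open scoped Classical in
/-- The part of the set `S` of defects whose elementary cubes lie inside `X`. -/
noncomputable def partIn (code : Code L D K A) (S : Finset A) (X : Set (Site L D)) :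
    Finset A :=
  S.filter fun a => ∀ v ∈ elemCube (code.loc a), v ∈ X

/-- The no-strings rule with constant `α`: for any Pauli operator supported in a
cube of linear size `Ltqo` whose syndrome is contained in two disjoint cubes of
linear size `ρ` at mutual distance at least `α·ρ`, the part of the syndrome in
each cube is neutral. -/
def noStrings (code : Code L D K A) (Ltqo α : ℝ) : Prop :=
  ∀ (E : Pauli (Site L D × Fin K)) (ρ : ℝ) (c₁ c₂ : Site L D), 0 < ρ →
    smallSupp E Ltqo →
    Disjoint (cubeSet c₁ ρ) (cubeSet c₂ ρ) →
    (∀ u ∈ cubeSet c₁ ρ, ∀ v ∈ cubeSet c₂ ρ, α * ρ ≤ ((dist' u v : ℕ) : ℝ)) →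
    (code.synSites (code.syndrome E) : Set (Site L D)) ⊆ cubeSet c₁ ρ ∪ cubeSet c₂ ρ →
    code.neutral Ltqo (code.partIn (code.syndrome E) (cubeSet c₁ ρ)) ∧
    code.neutral Ltqo (code.partIn (code.syndrome E) (cubeSet c₂ ρ))

/-- A logical operator: commutes with all generators but is not a stabilizer. -/
def logical (code : Code L D K A) (E : Pauli (Site L D × Fin K)) : Prop :=
  (∀ a, sympForm (code.G a) E = 0) ∧ E ∉ code.stab

/-- `P` has energy barrier at least `ω`: every error path implementing `P`
passes through a syndrome with at least `ω` defects. -/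
def barrierAtLeast (code : Code L D K A) (P : Pauli (Site L D × Fin K)) (ω : ℝ) : Prop :=
  ∀ (T : ℕ) (Ep : Fin T → Pauli (Site L D × Fin K)),
    (∀ t, singleQubit (Ep t)) → partialSum Ep T = P →
    ∃ t ≤ T, ω ≤ ((code.syndrome (partialSum Ep t)).card : ℝ)

end Code

end BH

namespace BH

/-- The `l_∞` diameter of a finite set of elementary cubes, each cube given by
its corner. -/
def cubesDiam {L D : ℕ} [NeZero L] (S : Finset (Site L D)) : ℕ :=
  fdiam (S.biUnion elemCube)

/-- `P` is a partition of the set `S` of elementary cubes into disjoint clusters,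
each of diameter at most `ξ(p)`, such that the union of any two distinct
clusters has diameter greater than `ξ(p+1)`. -/
def clusterPartition {L D : ℕ} [NeZero L] (α : ℝ) (p : ℕ)
    (S : Finset (Site L D)) (P : Finset (Finset (Site L D))) : Prop :=
  (∀ C ∈ P, C.Nonempty) ∧
  (∀ C ∈ P, C ⊆ S) ∧
  (∀ x ∈ S, ∃! C, C ∈ P ∧ x ∈ C) ∧
  (∀ C ∈ P, (cubesDiam C : ℝ) ≤ ξ α p) ∧
  (∀ C ∈ P, ∀ C' ∈ P, C ≠ C' → ξ α (p + 1) < (cubesDiam (C ∪ C') : ℝ))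

/-- A nonempty finite set of elementary cubes is sparse at level `p` iff it
admits a level-`p` cluster partition. -/
def sparseAt {L D : ℕ} [NeZero L] (α : ℝ) (p : ℕ) (S : Finset (Site L D)) : Prop :=
  ∃ P, clusterPartition α p S P

/-- A nonempty set of elementary cubes that is not sparse at level `p` is dense
at level `p`. -/
def denseAt {L D : ℕ} [NeZero L] (α : ℝ) (p : ℕ) (S : Finset (Site L D)) : Prop :=
  S.Nonempty ∧ ¬ sparseAt α p S

variable {L D K : ℕ} [NeZero L] {A : Type} [Fintype A]

/-- The set of elementary cubes (given by corners) occupied by the set `S`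
of defects. -/
def Code.synCubes (code : Code L D K A) (S : Finset A) : Finset (Site L D) :=
  S.image code.loc

/-- `t` is a time step of the level-`p` syndrome history of the error path
`Ep`: either an endpoint (`t = 0` or `t = T`), or the syndrome at time `t`
is dense at every level `q < p`. -/
def levelMember (code : Code L D K A) (α : ℝ) {T : ℕ}
    (Ep : Fin T → Pauli (Site L D × Fin K)) (p t : ℕ) : Prop :=
  t ≤ T ∧ (t = 0 ∨ t = T ∨
    ∀ q < p, denseAt α q (code.synCubes (code.syndrome (partialSum Ep t))))

set_option linter.unusedSectionVars false

/-! ### Metric lemmas -/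

theorem val_sub_le_of_le {u v : ZMod L} (h : v.val ≤ u.val) : (u - v).val = u.val - v.val :=
  ZMod.val_sub h

theorem cDist_comm (a b : ZMod L) : cDist a b = cDist b a := by
  unfold cDist; exact min_comm _ _

theorem cDist_self (a : ZMod L) : cDist a a = 0 := by
  simp [cDist]

theorem val_neg_add_val (a : ZMod L) (h : a ≠ 0) : (-a).val + a.val = L := by
  have : NeZero a := ⟨h⟩
  have := ZMod.val_neg_of_ne_zero a
  have := ZMod.val_lt a
  omega

theorem cDist_le_half (a b : ZMod L) : 2 * cDist a b ≤ L := by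
  unfold cDist
  by_cases h : a - b = 0
  · simp [h]
  · have h1 := val_neg_add_val (a - b) h
    rw [neg_sub] at h1
    have := min_le_left (a - b).val (b - a).val
    have := min_le_right (a - b).val (b - a).val
    omega

theorem cDist_triangle (a b c : ZMod L) : cDist a c ≤ cDist a b + cDist b c := by
  have key : ∀ x y : ZMod L, min (x + y).val (-(x + y)).val ≤
      min x.val (-x).val + min y.val (-y).val := by
    intro x y
    have e1 : (x + y).val ≤ x.val + y.val := ZMod.val_add_le x y
    have e2 : (-(x + y)).val ≤ (-x).val + (-y).val := by
      rw [neg_add]; exact ZMod.val_add_le _ _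
    by_cases hx : x = 0
    · simp [hx]
    by_cases hy : y = 0
    · simp [hy]
    by_cases hxy : x + y = 0
    · simp [hxy]
    have a1 := val_neg_add_val x hx
    have a2 := val_neg_add_val y hy
    have a3 := val_neg_add_val (x + y) hxy
    have hm1 : (x + y).val ≤ x.val - (-y).val ∨ (-(x + y)).val ≤ (-y).val - x.val := by
      rcases le_total (-y).val x.val with h | h
      · left
        have := ZMod.val_sub h
        rw [sub_neg_eq_add] at this
        omega
      · right
        have := ZMod.val_sub h
        have e : -y - x = -(x + y) := by ring
        rw [e] at this
        omega
    have hm2 : (x + y).val ≤ y.val - (-x).val ∨ (-(x + y)).val ≤ (-x).val - y.val := by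
      rcases le_total (-x).val y.val with h | h
      · left
        have := ZMod.val_sub h
        rw [sub_neg_eq_add, add_comm] at this
        omega
      · right
        have := ZMod.val_sub h
        have e : -x - y = -(x + y) := by ring
        rw [e] at this
        omega
    omega
  have := key (a - b) (b - c)
  unfold cDist
  simpa [sub_add_sub_cancel, neg_sub] using this

theorem dist'_comm (u v : Site L D) : dist' u v = dist' v u := by
  unfold dist'
  congr 1; funext i; exact cDist_comm _ _

theorem dist'_self (u : Site L D) : dist' u u = 0 := by
  unfold dist'
  apply Nat.eq_zero_of_le_zero
  apply Finset.sup_le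
  intro i _
  simp [cDist_self]

theorem dist'_triangle (u v w : Site L D) : dist' u w ≤ dist' u v + dist' v w := by
  unfold dist'
  apply Finset.sup_le
  intro i hi
  refine (cDist_triangle (u i) (v i) (w i)).trans ?_
  exact add_le_add (Finset.le_sup (f := fun i => cDist (u i) (v i)) hi)
    (Finset.le_sup (f := fun i => cDist (v i) (w i)) hi)

/-- Real-valued distance. -/
def dd (u v : Site L D) : ℝ := ((dist' u v : ℕ) : ℝ)

theorem dd_comm (u v : Site L D) : dd u v = dd v u := by
  unfold dd; rw [dist'_comm]

theorem dd_self (u : Site L D) : dd u u = 0 := by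
  unfold dd; rw [dist'_self]; simp

theorem dd_tri (u v w : Site L D) : dd u w ≤ dd u v + dd v w := by
  unfold dd; exact_mod_cast dist'_triangle u v w

theorem dd_half (u v : Site L D) : 2 * dd u v ≤ L := by
  unfold dd
  have : dist' u v ≤ L / 2 := by
    unfold dist'
    apply Finset.sup_le
    intro i _
    have := cDist_le_half (u i) (v i)
    omega
  have : 2 * dist' u v ≤ L := by omega
  exact_mod_cast this

theorem mem_ball_iff {r : ℝ} {X : Set (Site L D)} {v : Site L D} :
    v ∈ ball r X ↔ ∃ u ∈ X, dd u v ≤ r := Iff.rfl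

theorem cDist_le_dist' (u v : Site L D) (i : Fin D) : cDist (u i) (v i) ≤ dist' u v :=
  Finset.le_sup (f := fun i => cDist (u i) (v i)) (Finset.mem_univ i)

theorem cDist_le_of_val {a b c : ZMod L} {r : ℝ} (ha : ((a - c).val : ℝ) ≤ r)
    (hb : ((b - c).val : ℝ) ≤ r) : (cDist a b : ℝ) ≤ r := by
  unfold cDist
  rcases le_total (b - c).val (a - c).val with h | h
  · have := ZMod.val_sub h
    rw [sub_sub_sub_cancel_right] at this
    refine le_trans ?_ ha
    have h2 := min_le_left (a - b).val (b - a).val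
    exact_mod_cast (by omega : min (a - b).val (b - a).val ≤ (a - c).val)
  · have := ZMod.val_sub h
    rw [sub_sub_sub_cancel_right] at this
    refine le_trans ?_ hb
    have h2 := min_le_right (a - b).val (b - a).val
    exact_mod_cast (by omega : min (a - b).val (b - a).val ≤ (b - c).val)

theorem dd_le_of_cDist {u v : Site L D} {r : ℝ} (hr : 0 ≤ r)
    (h : ∀ i, (cDist (u i) (v i) : ℝ) ≤ r) : dd u v ≤ r := by
  unfold dd
  have : dist' u v ≤ ⌊r⌋₊ := by
    unfold dist'
    apply Finset.sup_le
    intro i _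
    exact Nat.le_floor (h i)
  exact (Nat.le_floor_iff hr).1 this

theorem dd_le_of_cubeSet {c u v : Site L D} {r : ℝ} (hr : 0 ≤ r)
    (hu : u ∈ cubeSet c r) (hv : v ∈ cubeSet c r) : dd u v ≤ r :=
  dd_le_of_cDist hr fun i => cDist_le_of_val (hu i) (hv i)

theorem dd_le_one_of_elemCube {c u v : Site L D}
    (hu : u ∈ elemCube c) (hv : v ∈ elemCube c) : dd u v ≤ 1 := by
  simp only [elemCube, Finset.mem_filter, Finset.mem_univ, true_and] at hu hv
  refine dd_le_of_cubeSet (c := c) zero_le_one (fun i => ?_) (fun i => ?_)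
  · exact_mod_cast hu i
  · exact_mod_cast hv i

theorem loc_mem_elemCube (c : Site L D) : c ∈ elemCube c := by
  simp [elemCube]

/-- A ball of radius `r` is contained in a cube of size `2r`. -/
theorem ball_subset_cube (z : Site L D) (r ℓ : ℝ) (hℓ : 2 * r ≤ ℓ) :
    ∃ c, ∀ v, dd z v ≤ r → v ∈ cubeSet c ℓ := by
  refine ⟨fun i => z i - (⌊r⌋₊ : ℕ), fun v hv i => ?_⟩
  have hr : 0 ≤ r := le_trans (by unfold dd; positivity) hv
  have h1 : cDist (z i) (v i) ≤ ⌊r⌋₊ := by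
    refine (cDist_le_dist' z v i).trans (Nat.le_floor hv)
  have h2 : (v i - (z i - (⌊r⌋₊ : ℕ))).val ≤ 2 * ⌊r⌋₊ := by
    unfold cDist at h1
    rcases min_le_iff.1 h1 with h | h
    · have e : v i - (z i - ((⌊r⌋₊ : ℕ) : ZMod L)) = ((⌊r⌋₊ - (z i - v i).val : ℕ) : ZMod L) := by
        rw [Nat.cast_sub h, ZMod.natCast_zmod_val]; ring
      rw [e, ZMod.val_natCast]
      exact (Nat.mod_le _ _).trans (by omega)
    · have e : v i - (z i - ((⌊r⌋₊ : ℕ) : ZMod L)) = (v i - z i) + ((⌊r⌋₊ : ℕ) : ZMod L) := by ring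
      rw [e]
      refine (ZMod.val_add_le _ _).trans ?_
      have : ((⌊r⌋₊ : ℕ) : ZMod L).val ≤ ⌊r⌋₊ := by
        rw [ZMod.val_natCast]; exact Nat.mod_le _ _
      omega
  have h3 : ((⌊r⌋₊ : ℕ) : ℝ) ≤ r := Nat.floor_le hr
  have h4 : (((v i - (z i - (⌊r⌋₊ : ℕ))).val : ℕ) : ℝ) ≤ ((2 * ⌊r⌋₊ : ℕ) : ℝ) := by
    exact_mod_cast h2
  push_cast at h4
  change (((v i - (z i - (⌊r⌋₊ : ℕ))).val : ℕ) : ℝ) ≤ ℓ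
  linarith

/-- One-dimensional Helly-type statement on the circle. -/
theorem circle_hull (X : Finset (ZMod L)) (hX : X.Nonempty) (d : ℕ) (hd : 3 * d < L)
    (h : ∀ u ∈ X, ∀ v ∈ X, cDist u v ≤ d) : ∃ c, ∀ v ∈ X, (v - c).val ≤ d := by
  obtain ⟨u0, hu0⟩ := hX
  obtain ⟨c, hc, hmax⟩ := Finset.exists_max_image (X.filter fun c => (u0 - c).val ≤ d)
    (fun c => (u0 - c).val) ⟨u0, by simp [hu0]⟩
  simp only [Finset.mem_filter] at hc hmax
  refine ⟨c, fun v hv => ?_⟩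
  rcases min_le_iff.1 (h v hv u0 hu0) with h1 | h1
  · -- `v` after `u0`
    have e : v - c = (v - u0) + (u0 - c) := by ring
    have h2 : (v - c).val ≤ (v - u0).val + (u0 - c).val := by
      rw [e]; exact ZMod.val_add_le _ _
    rcases min_le_iff.1 (h v hv c hc.1) with h3 | h3
    · exact h3
    · by_cases h0 : v - c = 0
      · simp [h0]
      · have := val_neg_add_val (v - c) h0
        rw [neg_sub] at this
        omega
  · have h2 := hmax v ⟨hv, h1⟩
    have := ZMod.val_sub h2
    rw [sub_sub_sub_cancel_left] at this
    omega

theorem cube_hull (X : Finset (Site L D)) (hX : X.Nonempty) (r : ℝ) (hr : 0 ≤ r)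
    (hL : 3 * r < L) (h : ∀ u ∈ X, ∀ v ∈ X, dd u v ≤ r) :
    ∃ c, ∀ v ∈ X, v ∈ cubeSet c r := by
  have hf : 3 * ⌊r⌋₊ < L := by
    have : ((⌊r⌋₊ : ℕ) : ℝ) ≤ r := Nat.floor_le hr
    have : ((3 * ⌊r⌋₊ : ℕ) : ℝ) < (L : ℝ) := by push_cast; linarith
    exact_mod_cast this
  have key : ∀ i : Fin D, ∃ c : ZMod L, ∀ v ∈ X.image (fun v => v i), (v - c).val ≤ ⌊r⌋₊ := by
    intro i
    apply circle_hull _ (hX.image _) _ hf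
    intro u hu v hv
    simp only [Finset.mem_image] at hu hv
    obtain ⟨u', hu', rfl⟩ := hu
    obtain ⟨v', hv', rfl⟩ := hv
    exact (cDist_le_dist' u' v' i).trans (Nat.le_floor (h u' hu' v' hv'))
  choose c hc using key
  refine ⟨c, fun v hv i => ?_⟩
  have := hc i (v i) (Finset.mem_image_of_mem _ hv)
  exact (Nat.le_floor_iff hr).1 this

theorem exists_minEnclosing (X : Set (Site L D)) : ∃ c ℓ, minEnclosing c ℓ X := by
  have hex : ∃ n : ℕ, ∃ c : Site L D, X ⊆ cubeSet c (n : ℝ) := by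
    refine ⟨L, 0, fun v _ i => ?_⟩
    exact_mod_cast (ZMod.val_lt _).le
  classical
  obtain ⟨c, hc⟩ := Nat.find_spec hex
  refine ⟨c, (Nat.find hex : ℕ), by positivity, hc, fun c' ℓ' h0 h => ?_⟩
  have h1 : X ⊆ cubeSet c' ((⌊ℓ'⌋₊ : ℕ) : ℝ) := by
    intro v hv i
    exact_mod_cast Nat.le_floor (h hv i)
  have h2 := Nat.find_min' hex ⟨c', h1⟩
  calc ((Nat.find hex : ℕ) : ℝ) ≤ ((⌊ℓ'⌋₊ : ℕ) : ℝ) := by exact_mod_cast h2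
    _ ≤ ℓ' := Nat.floor_le h0

/-! ### Symplectic form, syndromes, restrictions -/

theorem sympForm_add {Q : Type} [Fintype Q] (E F F' : Pauli Q) :
    sympForm E (F + F') = sympForm E F + sympForm E F' := by
  unfold sympForm
  rw [← Finset.sum_add_distrib]
  refine Finset.sum_congr rfl fun q _ => ?_
  simp only [Pi.add_apply, Prod.fst_add, Prod.snd_add]
  ring

theorem pauli_add_self {Q : Type} (E : Pauli Q) : E + E = 0 := by
  funext q
  refine Prod.ext ?_ ?_
  · exact CharTwo.add_self_eq_zero _
  · exact CharTwo.add_self_eq_zero _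

theorem pauli_neg {Q : Type} (E : Pauli Q) : -E = E :=
  (eq_neg_of_add_eq_zero_left (pauli_add_self E)).symm

theorem pauli_sub {Q : Type} (E F : Pauli Q) : E - F = E + F := by
  rw [sub_eq_add_neg, pauli_neg]

theorem mem_syn (code : Code L D K A) (E : Pauli (Site L D × Fin K)) (a : A) :
    a ∈ code.syndrome E ↔ sympForm (code.G a) E = 1 := by
  simp [Code.syndrome]

theorem zmod2_xor : ∀ x y : ZMod 2, x + y = 1 ↔ ¬ (x = 1 ↔ y = 1) := by decide

theorem zmod2_zero : ∀ x : ZMod 2, x ≠ 1 → x = 0 := by decide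

theorem mem_syn_add (code : Code L D K A) (E F : Pauli (Site L D × Fin K)) (a : A) :
    a ∈ code.syndrome (E + F) ↔ ¬ (a ∈ code.syndrome E ↔ a ∈ code.syndrome F) := by
  rw [mem_syn, mem_syn, mem_syn, sympForm_add, zmod2_xor]

theorem syn_zero (code : Code L D K A) : code.syndrome 0 = ∅ := by
  ext a
  simp [mem_syn, sympForm]

theorem syn_stab (code : Code L D K A) {E : Pauli (Site L D × Fin K)} (h : E ∈ code.stab) :
    code.syndrome E = ∅ := by
  unfold Code.stab at h
  induction h using AddSubgroup.closure_induction with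
  | mem x hx =>
    obtain ⟨b, rfl⟩ := hx
    ext a
    simp [mem_syn, code.comm]
  | zero => exact syn_zero code
  | add x y _ _ hx hy =>
    ext a
    rw [mem_syn_add, hx, hy]; simp
  | neg x _ hx => rw [pauli_neg]; exact hx

theorem syn_eq_of_stab (code : Code L D K A) {E F : Pauli (Site L D × Fin K)}
    (h : E + F ∈ code.stab) : code.syndrome E = code.syndrome F := by
  have := syn_stab code h
  ext a
  have h2 := mem_syn_add code E F a
  rw [this] at h2
  simp only [Finset.notMem_empty, false_iff, not_not] at h2
  exact h2

theorem syn_touch (code : Code L D K A) {E : Pauli (Site L D × Fin K)} {a : A}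
    (h : a ∈ code.syndrome E) : ∃ q, E q ≠ 0 ∧ q.1 ∈ elemCube (code.loc a) := by
  by_contra hcon
  push Not at hcon
  rw [mem_syn] at h
  have : sympForm (code.G a) E = 0 := by
    unfold sympForm
    refine Finset.sum_eq_zero fun q _ => ?_
    by_cases hq : E q = 0
    · simp [hq]
    · have h1 : code.G a q = 0 := by
        by_contra h2
        exact hcon q hq (code.localGen a q h2)
      simp [h1]
  rw [this] at h
  exact absurd h (by decide)

open scoped Classical in
/-- Restriction of a Pauli operator to a set of sites. -/
noncomputable def res (V : Pauli (Site L D × Fin K)) (X : Set (Site L D)) :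
    Pauli (Site L D × Fin K) := fun q => if q.1 ∈ X then V q else 0

theorem res_ne {V : Pauli (Site L D × Fin K)} {X : Set (Site L D)} {q} (h : res V X q ≠ 0) :
    q.1 ∈ X ∧ V q ≠ 0 := by
  unfold res at h
  split_ifs at h with h1
  · exact ⟨h1, h⟩
  · exact absurd rfl h

theorem res_add_compl (V : Pauli (Site L D × Fin K)) (X : Set (Site L D)) :
    res V X + res V Xᶜ = V := by
  funext q
  simp only [res, Pi.add_apply, Set.mem_compl_iff]
  by_cases h : q.1 ∈ X <;> simp [h]

/-- `X` is separated from the rest of the support of `V`. -/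
def closedIn (V : Pauli (Site L D × Fin K)) (X : Set (Site L D)) : Prop :=
  ∀ u ∈ X, ∀ q, V q ≠ 0 → dd u q.1 ≤ 1 → q.1 ∈ X

theorem mem_syn_res (code : Code L D K A) {V : Pauli (Site L D × Fin K)} {X : Set (Site L D)}
    (hX : closedIn V X) (a : A) :
    a ∈ code.syndrome (res V X) ↔
      a ∈ code.syndrome V ∧ ∃ q, V q ≠ 0 ∧ q.1 ∈ X ∧ q.1 ∈ elemCube (code.loc a) := by
  have key : (∃ q, V q ≠ 0 ∧ q.1 ∈ X ∧ q.1 ∈ elemCube (code.loc a)) →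
      a ∉ code.syndrome (res V Xᶜ) := by
    rintro ⟨q, hq, hqX, hqa⟩ ha
    obtain ⟨q', hq', hqa'⟩ := syn_touch code ha
    obtain ⟨h1, h2⟩ := res_ne hq'
    exact h1 (hX q.1 hqX q' h2 (dd_le_one_of_elemCube hqa hqa'))
  have hadd := mem_syn_add code (res V X) (res V Xᶜ) a
  rw [res_add_compl] at hadd
  constructor
  · intro h
    have ht : ∃ q, V q ≠ 0 ∧ q.1 ∈ X ∧ q.1 ∈ elemCube (code.loc a) := by
      obtain ⟨q, hq, hqa⟩ := syn_touch code h
      obtain ⟨h1, h2⟩ := res_ne hq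
      exact ⟨q, h2, h1, hqa⟩
    refine ⟨hadd.2 fun hh => key ht (hh.1 h), ht⟩
  · rintro ⟨h, ht⟩
    have h5 := key ht
    by_contra h6
    exact hadd.1 h (iff_of_false h6 h5)

/-- Localized syndrome of a restriction. -/
theorem mem_syn_res' (code : Code L D K A) {V : Pauli (Site L D × Fin K)} {X : Set (Site L D)}
    (hX : closedIn V X) (S W C C' : A → Prop)
    (hsyn : ∀ a, a ∈ code.syndrome V ↔ ¬ (S a ↔ W a))
    (hin : ∀ a, C a ∨ C' a → ∀ v ∈ elemCube (code.loc a), v ∈ X)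
    (hS : ∀ a, ∀ v ∈ elemCube (code.loc a), v ∈ X → (S a ↔ C a))
    (hW : ∀ a, ∀ v ∈ elemCube (code.loc a), v ∈ X → (W a ↔ C' a)) (a : A) :
    a ∈ code.syndrome (res V X) ↔ ¬ (C a ↔ C' a) := by
  rw [mem_syn_res code hX]
  constructor
  · rintro ⟨h, q, hq, hqX, hqa⟩
    rw [hsyn, hS a _ hqa hqX, hW a _ hqa hqX] at h
    exact h
  · intro h
    have h1 : C a ∨ C' a := by tauto
    have h2 := hin a h1
    have hl := loc_mem_elemCube (code.loc a)
    have h3 : a ∈ code.syndrome V := by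
      rw [hsyn, hS a _ hl (h2 _ hl), hW a _ hl (h2 _ hl)]; exact h
    obtain ⟨q, hq, hqa⟩ := syn_touch code h3
    exact ⟨h3, q, hq, h2 _ hqa, hqa⟩

/-- `V` is equivalent modulo stabilizers to an operator supported on `Y`. -/
def inM (code : Code L D K A) (Y : Set (Site L D)) (V : Pauli (Site L D × Fin K)) : Prop :=
  ∃ H, suppIn H Y ∧ V + H ∈ code.stab

theorem suppIn_add {E F : Pauli (Site L D × Fin K)} {Y : Set (Site L D)}
    (hE : suppIn E Y) (hF : suppIn F Y) : suppIn (E + F) Y := by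
  intro q hq
  by_cases h : E q = 0
  · apply hF q
    intro h2
    apply hq
    simp [h, h2]
  · exact hE q h

theorem suppIn_mono {E : Pauli (Site L D × Fin K)} {Y Y' : Set (Site L D)} (h : Y ⊆ Y')
    (hE : suppIn E Y) : suppIn E Y' := fun q hq => h (hE q hq)

theorem inM_add (code : Code L D K A) {Y : Set (Site L D)} {V V' : Pauli (Site L D × Fin K)}
    (h : inM code Y V) (h' : inM code Y V') : inM code Y (V + V') := by
  obtain ⟨H, h1, h2⟩ := h
  obtain ⟨H', h1', h2'⟩ := h'
  refine ⟨H + H', suppIn_add h1 h1', ?_⟩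
  have := code.stab.add_mem h2 h2'
  rwa [add_add_add_comm] at this

theorem inM_of_supp (code : Code L D K A) {Y : Set (Site L D)} {V : Pauli (Site L D × Fin K)}
    (h : suppIn V Y) : inM code Y V :=
  ⟨V, h, by rw [pauli_add_self]; exact code.stab.zero_mem⟩

theorem inM_of_stab (code : Code L D K A) {Y : Set (Site L D)} {V : Pauli (Site L D × Fin K)}
    (h : V ∈ code.stab) : inM code Y V :=
  ⟨0, fun q hq => absurd rfl hq, by rw [add_zero]; exact h⟩

theorem inM_mono (code : Code L D K A) {Y Y' : Set (Site L D)} (h : Y ⊆ Y')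
    {V : Pauli (Site L D × Fin K)} (hV : inM code Y V) : inM code Y' V := by
  obtain ⟨H, h1, h2⟩ := hV
  exact ⟨H, suppIn_mono h h1, h2⟩

/-- Cleaning lemma. -/
theorem clean (code : Code L D K A) {Ltqo : ℝ} (h1 : code.tqo1 Ltqo) (Y : Set (Site L D)) :
    ∀ (n : ℕ) (V : Pauli (Site L D × Fin K)), pweight V ≤ n →
      (∀ q, V q ≠ 0 → q.1 ∉ Y → ∃ X : Set (Site L D), q.1 ∈ X ∧ (∃ c, X ⊆ cubeSet c Ltqo) ∧
        closedIn V X ∧ ∀ a ∈ code.syndrome V, ∀ v ∈ elemCube (code.loc a), v ∉ X) →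
      inM code Y V := by
  intro n
  induction n with
  | zero =>
    intro V hV _
    apply inM_of_supp
    intro q hq
    exfalso
    have : pweight V = 0 := by omega
    unfold pweight at this
    rw [Finset.card_eq_zero] at this
    have hm : q ∈ (Finset.univ.filter fun q => V q ≠ 0) := by simp [hq]
    rw [this] at hm
    simp at hm
  | succ n ih =>
    intro V hV hyp
    by_cases hY : suppIn V Y
    · exact inM_of_supp code hY
    unfold suppIn at hY
    push Not at hY
    obtain ⟨q, hq, hqY⟩ := hY
    obtain ⟨X, hqX, ⟨c, hc⟩, hcl, hsyn⟩ := hyp q hq hqY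
    have hst : res V X ∈ code.stab := by
      apply h1
      · exact ⟨c, fun q hq => hc (res_ne hq).1⟩
      · ext a
        rw [mem_syn_res code hcl]
        simp only [Finset.notMem_empty, iff_false]
        rintro ⟨ha, q', _, hX', hqa⟩
        exact hsyn a ha _ hqa hX'
    have hsyneq : code.syndrome (res V Xᶜ) = code.syndrome V := by
      apply syn_eq_of_stab
      have : res V Xᶜ + V = res V X := by
        have h3 : res V X + res V Xᶜ + res V Xᶜ = V + res V Xᶜ := by rw [res_add_compl]
        rw [add_assoc, pauli_add_self, add_zero] at h3
        rw [h3, add_comm]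
      rw [this]; exact hst
    have hM : inM code Y (res V Xᶜ) := by
      apply ih
      · have : pweight (res V Xᶜ) < pweight V := by
          unfold pweight
          apply Finset.card_lt_card
          rw [Finset.ssubset_iff_of_subset]
          · refine ⟨q, by simp [hq], ?_⟩
            intro hm
            simp only [Finset.mem_filter, Finset.mem_univ, true_and] at hm
            exact (res_ne hm).1 hqX
          · intro q' hq'
            simp only [Finset.mem_filter, Finset.mem_univ, true_and] at hq' ⊢
            exact (res_ne hq').2
        omega
      · intro q' hq' hqY'
        obtain ⟨X', hqX', hc', hcl', hsyn'⟩ := hyp q' (res_ne hq').2 hqY'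
        refine ⟨X', hqX', hc', ?_, ?_⟩
        · intro u hu q2 hq2 hd
          exact hcl' u hu q2 (res_ne hq2).2 hd
        · rw [hsyneq]; exact hsyn'
    have := inM_add code (inM_of_stab code hst (Y := Y)) hM
    rwa [res_add_compl] at this

/-! ### Clusterings -/

/-- A clustering of a set of defects, with hulls `q a` of linear size at most `x`. -/
structure Clustering (code : Code L D K A) (Ltqo x : ℝ) (S : Finset A) (cl : A → Finset A)
    (q : A → Set (Site L D)) : Prop where
  mem : ∀ a ∈ S, a ∈ cl a
  sub : ∀ a ∈ S, cl a ⊆ S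
  eqv : ∀ a ∈ S, ∀ b ∈ cl a, cl b = cl a ∧ q b = q a
  hull : ∀ a ∈ S, ∀ v ∈ elemCube (code.loc a), v ∈ q a
  size : ∀ a ∈ S, ∃ c, q a ⊆ cubeSet c x
  neut : ∀ a ∈ S, code.neutral Ltqo (cl a) → ∃ n, code.syndrome n = cl a ∧ suppIn n (ball 1 (q a))
  sep : ∀ a ∈ S, ∀ b ∈ S, b ∉ cl a → ∀ u ∈ q a, ∀ v ∈ q b, 8 * x < dd u v

/-- The union of the hulls. -/
def hullS (S : Finset A) (q : A → Set (Site L D)) : Set (Site L D) := {v | ∃ a ∈ S, v ∈ q a}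

section
variable {code : Code L D K A} {Ltqo x : ℝ} {S S' : Finset A} {cl cl' : A → Finset A}
  {q q' : A → Set (Site L D)}

theorem Clustering.diam (hC : Clustering code Ltqo x S cl q) (hx : 1 ≤ x) {a : A} (ha : a ∈ S)
    {u v : Site L D} (hu : u ∈ q a) (hv : v ∈ q a) : dd u v ≤ x := by
  obtain ⟨c, hc⟩ := hC.size a ha
  exact dd_le_of_cubeSet (by linarith) (hc hu) (hc hv)

theorem Clustering.loc_mem (hC : Clustering code Ltqo x S cl q) {a : A} (ha : a ∈ S) :
    code.loc a ∈ q a := hC.hull a ha _ (loc_mem_elemCube _)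

theorem Clustering.hull' (hC : Clustering code Ltqo x S cl q) {a b : A} (ha : a ∈ S)
    (hb : b ∈ cl a) : ∀ v ∈ elemCube (code.loc b), v ∈ q a := by
  intro v hv
  have := hC.hull b (hC.sub a ha hb) v hv
  rwa [(hC.eqv a ha b hb).2] at this

theorem ball_self {r : ℝ} (hr : 0 ≤ r) {X : Set (Site L D)} : X ⊆ ball r X := by
  intro v hv
  exact ⟨v, hv, by change dd v v ≤ r; rw [dd_self]; exact hr⟩

theorem ball_mono {r r' : ℝ} (hr : r ≤ r') {X X' : Set (Site L D)} (h : X ⊆ X') :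
    ball r X ⊆ ball r' X' := by
  rintro v ⟨u, hu, hd⟩
  exact ⟨u, h hu, le_trans hd hr⟩

theorem Clustering.sites_sub (hC : Clustering code Ltqo x S cl q) :
    (code.synSites S : Set (Site L D)) ⊆ hullS S q := by
  intro v hv
  simp only [Code.synSites, Finset.coe_biUnion, Set.mem_iUnion] at hv
  obtain ⟨a, ha, hv⟩ := hv
  exact ⟨a, ha, hC.hull a ha v hv⟩

theorem mem_synSites {v : Site L D} :
    v ∈ (code.synSites S : Set (Site L D)) ↔ ∃ a ∈ S, v ∈ elemCube (code.loc a) := by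
  simp [Code.synSites]

/-- Touching the ball around a hull means membership in the cluster. -/
theorem Clustering.touch (hC : Clustering code Ltqo x S cl q) (hx : 1 ≤ x) {a b : A} (ha : a ∈ S)
    (hb : b ∈ S) {v : Site L D} (hv : v ∈ elemCube (code.loc b)) (hvX : v ∈ ball x (q a)) :
    b ∈ cl a := by
  by_contra hcon
  obtain ⟨u, hu, hd⟩ := hvX
  change dd u v ≤ x at hd
  have := hC.sep a ha b hb hcon u hu v (hC.hull b hb v hv)
  linarith

theorem closedA (hC : Clustering code Ltqo x S cl q) (hx : 1 ≤ x) {W : Set (Site L D)}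
    {V : Pauli (Site L D × Fin K)} (hV : suppIn V (ball x (hullS S q) ∪ ball x W)) {a : A}
    (ha : a ∈ S) (hfar : ∀ u ∈ q a, ∀ w ∈ W, 3 * x < dd u w) : closedIn V (ball x (q a)) := by
  rintro u ⟨u0, hu0, hd0⟩ p hp hd
  change dd u0 u ≤ x at hd0
  have t1 := dd_tri u0 u p.1
  rcases hV p hp with ⟨w, ⟨b, hb, hwb⟩, hdw⟩ | ⟨w, hw, hdw⟩
  · change dd w p.1 ≤ x at hdw
    have t2 := dd_tri u0 p.1 w
    rw [dd_comm p.1 w] at t2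
    by_cases hbc : b ∈ cl a
    · rw [(hC.eqv a ha b hbc).2] at hwb
      exact ⟨w, hwb, hdw⟩
    · have := hC.sep a ha b hb hbc u0 hu0 w hwb
      linarith
  · change dd w p.1 ≤ x at hdw
    have t2 := dd_tri u0 p.1 w
    rw [dd_comm p.1 w] at t2
    have := hfar u0 hu0 w hw
    linarith

theorem synA (hC : Clustering code Ltqo x S cl q) (hx : 1 ≤ x) {W : Finset A}
    {Ws : Set (Site L D)} (hW : (code.synSites W : Set (Site L D)) ⊆ Ws)
    {V : Pauli (Site L D × Fin K)} (hV : suppIn V (ball x (hullS S q) ∪ ball x Ws))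
    (hsyn : ∀ a, a ∈ code.syndrome V ↔ ¬ (a ∈ S ↔ a ∈ W)) {a : A}
    (ha : a ∈ S) (hfar : ∀ u ∈ q a, ∀ w ∈ Ws, 3 * x < dd u w) :
    code.syndrome (res V (ball x (q a))) = cl a := by
  ext b
  rw [mem_syn_res' code (closedA hC hx hV ha hfar) (· ∈ S) (· ∈ W) (· ∈ cl a) (fun _ => False)
    hsyn]
  · simp
  · rintro b (hb | hb) v hv
    · exact ball_self (by linarith) (hC.hull' ha hb v hv)
    · exact hb.elim
  · intro b v hv hvX
    exact ⟨fun hb => hC.touch hx ha hb hv hvX, fun hb => hC.sub a ha hb⟩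
  · rintro b v hv ⟨u, hu, hd⟩
    change dd u v ≤ x at hd
    refine ⟨fun hb => ?_, fun h => h.elim⟩
    have := hfar u hu v (hW (mem_synSites.2 ⟨b, hb, hv⟩))
    linarith

/-- closedness for a pair of clusters. -/
theorem closedB (hC : Clustering code Ltqo x S cl q) (hC' : Clustering code Ltqo x S' cl' q')
    (hx : 1 ≤ x)
    {V : Pauli (Site L D × Fin K)} (hV : suppIn V (ball x (hullS S q) ∪ ball x (hullS S' q')))
    {a b : A} (ha : a ∈ S) (hb : b ∈ S') {u0 v0 : Site L D} (hu0 : u0 ∈ q a) (hv0 : v0 ∈ q' b)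
    (hd0 : dd u0 v0 ≤ 3 * x) : closedIn V (ball x (q a) ∪ ball x (q' b)) := by
  have key : ∀ u, u ∈ ball x (q a) ∪ ball x (q' b) →
      (∀ c ∈ S, ∀ w ∈ q c, dd u w ≤ x + 1 → c ∈ cl a) ∧
      (∀ c ∈ S', ∀ w ∈ q' c, dd u w ≤ x + 1 → c ∈ cl' b) := by
    rintro u (⟨u1, hu1, hd1⟩ | ⟨u1, hu1, hd1⟩) <;> change dd u1 u ≤ x at hd1
    · constructor
      · intro c hc w hw hd
        by_contra hcon
        have := hC.sep a ha c hc hcon u1 hu1 w hw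
        have := dd_tri u1 u w
        linarith
      · intro c hc w hw hd
        by_contra hcon
        have := hC'.sep b hb c hc hcon v0 hv0 w hw
        have := dd_tri u1 u w
        have := dd_tri v0 u0 w
        have := dd_tri u0 u1 w
        have := hC.diam hx ha hu0 hu1
        have := dd_comm u0 v0
        linarith
    · constructor
      · intro c hc w hw hd
        by_contra hcon
        have := hC.sep a ha c hc hcon u0 hu0 w hw
        have := dd_tri u1 u w
        have := dd_tri u0 v0 w
        have := dd_tri v0 u1 w
        have := hC'.diam hx hb hv0 hu1
        linarith
      · intro c hc w hw hd
        by_contra hcon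
        have := hC'.sep b hb c hc hcon u1 hu1 w hw
        have := dd_tri u1 u w
        linarith
  intro u hu p hp hd
  rcases hV p hp with ⟨w, ⟨c, hc, hwc⟩, hdw⟩ | ⟨w, ⟨c, hc, hwc⟩, hdw⟩ <;>
    change dd w p.1 ≤ x at hdw
  · have t := dd_tri u p.1 w
    rw [dd_comm p.1 w] at t
    have := (key u hu).1 c hc w hwc (by linarith)
    rw [(hC.eqv a ha c this).2] at hwc
    exact Or.inl ⟨w, hwc, hdw⟩
  · have t := dd_tri u p.1 w
    rw [dd_comm p.1 w] at t
    have := (key u hu).2 c hc w hwc (by linarith)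
    rw [(hC'.eqv b hb c this).2] at hwc
    exact Or.inr ⟨w, hwc, hdw⟩

theorem touchB (hC : Clustering code Ltqo x S cl q) (hC' : Clustering code Ltqo x S' cl' q')
    (hx : 1 ≤ x) {a b : A} (ha : a ∈ S) (hb : b ∈ S') {u0 v0 : Site L D} (hu0 : u0 ∈ q a)
    (hv0 : v0 ∈ q' b) (hd0 : dd u0 v0 ≤ 3 * x) {c : A} (hc : c ∈ S) {v : Site L D}
    (hv : v ∈ elemCube (code.loc c)) (hvX : v ∈ ball x (q a) ∪ ball x (q' b)) : c ∈ cl a := by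
  rcases hvX with h | ⟨u1, hu1, hd1⟩
  · exact hC.touch hx ha hc hv h
  · change dd u1 v ≤ x at hd1
    by_contra hcon
    have := hC.sep a ha c hc hcon u0 hu0 v (hC.hull c hc v hv)
    have := dd_tri u0 v0 v
    have := dd_tri v0 u1 v
    have := hC'.diam hx hb hv0 hu1
    linarith

theorem synB (hC : Clustering code Ltqo x S cl q) (hC' : Clustering code Ltqo x S' cl' q')
    (hx : 1 ≤ x)
    {V : Pauli (Site L D × Fin K)} (hV : suppIn V (ball x (hullS S q) ∪ ball x (hullS S' q')))
    (hsyn : ∀ a, a ∈ code.syndrome V ↔ ¬ (a ∈ S ↔ a ∈ S'))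
    {a b : A} (ha : a ∈ S) (hb : b ∈ S') {u0 v0 : Site L D} (hu0 : u0 ∈ q a) (hv0 : v0 ∈ q' b)
    (hd0 : dd u0 v0 ≤ 3 * x) (c : A) :
    c ∈ code.syndrome (res V (ball x (q a) ∪ ball x (q' b))) ↔ ¬ (c ∈ cl a ↔ c ∈ cl' b) := by
  apply mem_syn_res' code (closedB hC hC' hx hV ha hb hu0 hv0 hd0) (· ∈ S) (· ∈ S')
    (· ∈ cl a) (· ∈ cl' b) hsyn
  · rintro c (hc | hc) v hv
    · exact Or.inl (ball_self (by linarith) (hC.hull' ha hc v hv))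
    · exact Or.inr (ball_self (by linarith) (hC'.hull' hb hc v hv))
  · intro c v hv hvX
    exact ⟨fun hc => touchB hC hC' hx ha hb hu0 hv0 hd0 hc hv hvX, fun hc => hC.sub a ha hc⟩
  · intro c v hv hvX
    refine ⟨fun hc => touchB hC' hC hx hb ha hv0 hu0 ?_ hc hv ?_, fun hc => hC'.sub b hb hc⟩
    · rw [dd_comm]; exact hd0
    · exact hvX.symm

/-- The neutral operator. -/
theorem exists_neutralOp (hC : Clustering code Ltqo x S cl q) (hx : 1 ≤ x) :
    ∃ N, (∀ a, a ∈ code.syndrome N ↔ a ∈ S ∧ code.neutral Ltqo (cl a)) ∧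
      suppIn N (ball x (hullS S q)) := by
  classical
  have key : ∀ n : ℕ, ∀ U : Finset A, U.card ≤ n → U ⊆ S →
      (∀ a ∈ U, cl a ⊆ U ∧ code.neutral Ltqo (cl a)) →
      ∃ N, code.syndrome N = U ∧ suppIn N (ball x (hullS S q)) := by
    intro n
    induction n with
    | zero =>
      intro U hU _ _
      have : U = ∅ := Finset.card_eq_zero.1 (by omega)
      exact ⟨0, by rw [this, syn_zero], fun q hq => absurd rfl hq⟩
    | succ n ih =>
      intro U hU hUS hUn
      by_cases hne : U = ∅
      · exact ⟨0, by rw [hne, syn_zero], fun q hq => absurd rfl hq⟩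
      obtain ⟨a, ha⟩ := Finset.nonempty_iff_ne_empty.2 hne
      have haS := hUS ha
      obtain ⟨hsub, hneu⟩ := hUn a ha
      obtain ⟨n1, hn1, hn1s⟩ := hC.neut a haS hneu
      obtain ⟨N, hN, hNs⟩ := ih (U \ cl a) (by
          have : (U \ cl a).card < U.card := by
            apply Finset.card_lt_card
            rw [Finset.ssubset_iff_of_subset Finset.sdiff_subset]
            exact ⟨a, ha, by simp [hC.mem a haS]⟩
          omega) (Finset.sdiff_subset.trans hUS) (by
          intro b hb
          rw [Finset.mem_sdiff] at hb
          refine ⟨fun c hc => ?_, (hUn b hb.1).2⟩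
          rw [Finset.mem_sdiff]
          refine ⟨(hUn b hb.1).1 hc, fun hca => hb.2 ?_⟩
          have e1 := (hC.eqv a haS c hca).1
          have e2 := (hC.eqv b (hUS hb.1) c hc).1
          rw [← e1, e2]
          exact hC.mem b (hUS hb.1))
      refine ⟨n1 + N, ?_, suppIn_add (suppIn_mono ?_ hn1s) hNs⟩
      · ext b
        rw [mem_syn_add, hn1, hN, Finset.mem_sdiff]
        have := @hsub b
        tauto
      · exact ball_mono hx fun v hv => ⟨a, haS, hv⟩
  obtain ⟨N, hN, hNs⟩ := key _ (S.filter fun a => code.neutral Ltqo (cl a)) le_rfl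
    (Finset.filter_subset _ _) (by
      intro a ha
      rw [Finset.mem_filter] at ha
      refine ⟨fun b hb => ?_, ha.2⟩
      rw [Finset.mem_filter, (hC.eqv a ha.1 b hb).1]
      exact ⟨hC.sub a ha.1 hb, ha.2⟩)
  exact ⟨N, fun a => by rw [hN, Finset.mem_filter], hNs⟩

end

/-! ### Neutral and charged clusters -/

theorem smallSupp_of_dd {E : Pauli (Site L D × Fin K)} (z : Site L D) {r ℓ : ℝ} (hr : 2 * r ≤ ℓ)
    (h : ∀ p, E p ≠ 0 → dd z p.1 ≤ r) : smallSupp E ℓ := by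
  obtain ⟨c, hc⟩ := ball_subset_cube z r ℓ hr
  exact ⟨c, fun p hp => hc _ (h p hp)⟩

theorem tqo2_local (code : Code L D K A) {Ltqo : ℝ} (h2 : code.tqo2 Ltqo) {W : Finset A}
    (hW : code.neutral Ltqo W) {r : ℝ} (hr : 0 ≤ r) (hL : 3 * r < L)
    (hd : ∀ u ∈ code.synSites W, ∀ v ∈ code.synSites W, dd u v ≤ r)
    {s : Site L D} (hs : s ∈ code.synSites W) :
    ∃ f, code.syndrome f = W ∧ ∀ p, f p ≠ 0 → dd s p.1 ≤ r + 1 := by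
  obtain ⟨c, ℓ, hmin⟩ := exists_minEnclosing (code.synSites W : Set (Site L D))
  obtain ⟨f, hf, hfs⟩ := h2 W hW c ℓ hmin
  obtain ⟨c', hc'⟩ := cube_hull _ ⟨s, hs⟩ r hr hL hd
  have hℓ : ℓ ≤ r := hmin.2.2 c' r hr fun v hv => hc' v hv
  refine ⟨f, hf, fun p hp => ?_⟩
  obtain ⟨u, hu, hdu⟩ := hfs p hp
  change dd u p.1 ≤ 1 at hdu
  have := dd_le_of_cubeSet hmin.1 (hmin.2.1 hs) hu
  have := dd_tri s u p.1
  linarith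

section
variable {code : Code L D K A} {Ltqo x : ℝ} {S S' : Finset A} {cl cl' : A → Finset A}
  {q q' : A → Set (Site L D)}

theorem neutralA (hC : Clustering code Ltqo x S cl q) (hx : 1 ≤ x) (hT : 40 * x ≤ Ltqo)
    {W : Finset A}
    {Ws : Set (Site L D)} (hW : (code.synSites W : Set (Site L D)) ⊆ Ws)
    {V : Pauli (Site L D × Fin K)} (hV : suppIn V (ball x (hullS S q) ∪ ball x Ws))
    (hsyn : ∀ a, a ∈ code.syndrome V ↔ ¬ (a ∈ S ↔ a ∈ W)) {a : A}
    (ha : a ∈ S) (hfar : ∀ u ∈ q a, ∀ w ∈ Ws, 3 * x < dd u w) :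
    code.neutral Ltqo (cl a) := by
  refine ⟨_, synA hC hx hW hV hsyn ha hfar, smallSupp_of_dd (code.loc a) (r := 2 * x)
    (by linarith) ?_⟩
  intro p hp
  obtain ⟨⟨u, hu, hd⟩, _⟩ := res_ne hp
  change dd u p.1 ≤ x at hd
  have := hC.diam hx ha (hC.loc_mem ha) hu
  have := dd_tri (code.loc a) u p.1
  linarith

theorem chargedNear (hC : Clustering code Ltqo x S cl q) (hx : 1 ≤ x) (hT : 40 * x ≤ Ltqo)
    {W : Finset A}
    {Ws : Set (Site L D)} (hW : (code.synSites W : Set (Site L D)) ⊆ Ws)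
    {V : Pauli (Site L D × Fin K)} (hV : suppIn V (ball x (hullS S q) ∪ ball x Ws))
    (hsyn : ∀ a, a ∈ code.syndrome V ↔ ¬ (a ∈ S ↔ a ∈ W)) {a : A}
    (ha : a ∈ S) (hch : ¬ code.neutral Ltqo (cl a)) :
    ∃ u ∈ q a, ∃ w ∈ Ws, dd u w ≤ 3 * x := by
  by_contra hcon
  push Not at hcon
  exact hch (neutralA hC hx hT hW hV hsyn ha hcon)

theorem pairBall (hC : Clustering code Ltqo x S cl q) (hC' : Clustering code Ltqo x S' cl' q')
    (hx : 1 ≤ x) {a b : A} (ha : a ∈ S) (hb : b ∈ S') {u0 v0 : Site L D} (hu0 : u0 ∈ q a)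
    (hv0 : v0 ∈ q' b) (hd0 : dd u0 v0 ≤ 3 * x) {v : Site L D}
    (hv : v ∈ ball x (q a) ∪ ball x (q' b)) : dd u0 v ≤ 5 * x := by
  rcases hv with ⟨u1, hu1, hd1⟩ | ⟨u1, hu1, hd1⟩ <;> change dd u1 v ≤ x at hd1
  · have := hC.diam hx ha hu0 hu1
    have := dd_tri u0 u1 v
    linarith
  · have := hC'.diam hx hb hv0 hu1
    have := dd_tri u0 u1 v
    have := dd_tri u0 v0 u1
    linarith

theorem neutralB (hC : Clustering code Ltqo x S cl q) (hC' : Clustering code Ltqo x S' cl' q')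
    (hx : 1 ≤ x) (hT : 40 * x ≤ Ltqo)
    {V : Pauli (Site L D × Fin K)} (hV : suppIn V (ball x (hullS S q) ∪ ball x (hullS S' q')))
    (hsyn : ∀ a, a ∈ code.syndrome V ↔ ¬ (a ∈ S ↔ a ∈ S'))
    {a b : A} (ha : a ∈ S) (hb : b ∈ S') {u0 v0 : Site L D} (hu0 : u0 ∈ q a) (hv0 : v0 ∈ q' b)
    (hd0 : dd u0 v0 ≤ 3 * x) (hn : code.neutral Ltqo (cl a)) : code.neutral Ltqo (cl' b) := by
  obtain ⟨n, hn1, hn2⟩ := hC.neut a ha hn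
  refine ⟨n + res V (ball x (q a) ∪ ball x (q' b)), ?_, smallSupp_of_dd u0 (r := 5 * x)
    (by linarith) ?_⟩
  · ext c
    rw [mem_syn_add, synB hC hC' hx hV hsyn ha hb hu0 hv0 hd0, hn1]
    tauto
  · intro p hp
    have : suppIn (n + res V (ball x (q a) ∪ ball x (q' b))) (ball x (q a) ∪ ball x (q' b)) := by
      apply suppIn_add
      · refine suppIn_mono ?_ hn2
        exact (ball_mono hx subset_rfl).trans Set.subset_union_left
      · intro p hp
        exact (res_ne hp).1
    exact pairBall hC hC' hx ha hb hu0 hv0 hd0 (this p hp)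

theorem endLemma (hC : Clustering code Ltqo x S cl q) (hx : 1 ≤ x) (hT : 40 * x ≤ Ltqo)
    (h1 : code.tqo1 Ltqo) {W : Finset A}
    {V : Pauli (Site L D × Fin K)}
    (hV : suppIn V (ball x (hullS S q) ∪ ball x (code.synSites W : Set (Site L D))))
    (hsyn : ∀ a, a ∈ code.syndrome V ↔ ¬ (a ∈ S ↔ a ∈ W))
    {N : Pauli (Site L D × Fin K)}
    (hN : ∀ a, a ∈ code.syndrome N ↔ a ∈ S ∧ code.neutral Ltqo (cl a))
    (hNs : suppIn N (ball x (hullS S q))) {Y : Set (Site L D)}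
    (hY : ball (5 * x) (code.synSites W : Set (Site L D)) ⊆ Y)
    (hYc : ∀ a ∈ S, ¬ code.neutral Ltqo (cl a) → ball x (q a) ⊆ Y) :
    inM code Y (V + N) := by
  have hs : suppIn (V + N) (ball x (hullS S q) ∪ ball x (code.synSites W : Set (Site L D))) :=
    suppIn_add hV (suppIn_mono Set.subset_union_left hNs)
  apply clean code h1 Y _ _ le_rfl
  intro p hp hpY
  rcases hs p hp with ⟨w, ⟨a, ha, hwa⟩, hdw⟩ | hw
  · change dd w p.1 ≤ x at hdw
    have hpX : p.1 ∈ ball x (q a) := ⟨w, hwa, hdw⟩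
    have hneu : code.neutral Ltqo (cl a) := by
      by_contra hcon
      exact hpY (hYc a ha hcon hpX)
    have hfar : ∀ u ∈ q a, ∀ w ∈ (code.synSites W : Set (Site L D)), 3 * x < dd u w := by
      intro u hu s hs
      by_contra hcon
      push Not at hcon
      apply hpY
      apply hY
      refine ⟨s, hs, ?_⟩
      change dd s p.1 ≤ 5 * x
      have := dd_tri s u p.1
      have := dd_tri u w p.1
      have := hC.diam hx ha hu hwa
      rw [dd_comm] at hcon
      linarith
    refine ⟨_, hpX, ?_, closedA hC hx hs ha hfar, ?_⟩
    · obtain ⟨c, hc⟩ := ball_subset_cube w (2 * x) Ltqo (by linarith)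
      refine ⟨c, ?_⟩
      rintro v ⟨u, hu, hd⟩
      change dd u v ≤ x at hd
      apply hc
      have := dd_tri w u v
      have := hC.diam hx ha hwa hu
      linarith
    · intro b hb v hv hvX
      rw [mem_syn_add, hsyn, hN] at hb
      have hbW : b ∉ W := by
        intro hbW
        obtain ⟨u, hu, hd⟩ := hvX
        change dd u v ≤ x at hd
        have := hfar u hu v (mem_synSites.2 ⟨b, hbW, hv⟩)
        linarith
      have hbS : b ∈ S → code.neutral Ltqo (cl b) := by
        intro hbS
        have := hC.touch hx ha hbS hv hvX
        rw [(hC.eqv a ha b this).1]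
        exact hneu
      tauto
  · exact absurd (hY (ball_mono (by linarith) subset_rfl hw)) hpY

theorem stepLemma (hC : Clustering code Ltqo x S cl q) (hC' : Clustering code Ltqo x S' cl' q')
    (hx : 1 ≤ x) (hT : 40 * x ≤ Ltqo) (h1 : code.tqo1 Ltqo)
    {V : Pauli (Site L D × Fin K)} (hV : suppIn V (ball x (hullS S q) ∪ ball x (hullS S' q')))
    (hsyn : ∀ a, a ∈ code.syndrome V ↔ ¬ (a ∈ S ↔ a ∈ S'))
    {N N' : Pauli (Site L D × Fin K)}
    (hN : ∀ a, a ∈ code.syndrome N ↔ a ∈ S ∧ code.neutral Ltqo (cl a))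
    (hNs : suppIn N (ball x (hullS S q)))
    (hN' : ∀ a, a ∈ code.syndrome N' ↔ a ∈ S' ∧ code.neutral Ltqo (cl' a))
    (hNs' : suppIn N' (ball x (hullS S' q'))) {Y : Set (Site L D)}
    (hY : ∀ a ∈ S, ¬ code.neutral Ltqo (cl a) → ball x (q a) ⊆ Y)
    (hY' : ∀ a ∈ S', ¬ code.neutral Ltqo (cl' a) → ball x (q' a) ⊆ Y) :
    inM code Y (V + N + N') := by
  have hs : suppIn (V + N + N') (ball x (hullS S q) ∪ ball x (hullS S' q')) :=
    suppIn_add (suppIn_add hV (suppIn_mono Set.subset_union_left hNs))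
      (suppIn_mono Set.subset_union_right hNs')
  have hVsw : suppIn V (ball x (hullS S' q') ∪ ball x (hullS S q)) := by
    rw [Set.union_comm]; exact hV
  have hssw : suppIn (V + N + N') (ball x (hullS S' q') ∪ ball x (hullS S q)) := by
    rw [Set.union_comm]; exact hs
  have hsynsw : ∀ a, a ∈ code.syndrome V ↔ ¬ (a ∈ S' ↔ a ∈ S) := by
    intro a; rw [hsyn, iff_comm (a := a ∈ S)]
  have hsynT : ∀ b, b ∈ code.syndrome (V + N + N') →
      (b ∈ S ∧ ¬ code.neutral Ltqo (cl b)) ∨ (b ∈ S' ∧ ¬ code.neutral Ltqo (cl' b)) := by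
    intro b hb
    rw [mem_syn_add, mem_syn_add, hsyn, hN, hN'] at hb
    tauto
  -- pairs of matched neutral clusters
  have pair : ∀ a ∈ S, ∀ b ∈ S', code.neutral Ltqo (cl a) → code.neutral Ltqo (cl' b) →
      ∀ u0 ∈ q a, ∀ v0 ∈ q' b, dd u0 v0 ≤ 3 * x →
      (∃ c, ball x (q a) ∪ ball x (q' b) ⊆ cubeSet c Ltqo) ∧
        closedIn (V + N + N') (ball x (q a) ∪ ball x (q' b)) ∧
        ∀ d ∈ code.syndrome (V + N + N'), ∀ v ∈ elemCube (code.loc d),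
          v ∉ ball x (q a) ∪ ball x (q' b) := by
    intro a ha b hb hna hnb u0 hu0 v0 hv0 hd0
    refine ⟨?_, closedB hC hC' hx hs ha hb hu0 hv0 hd0, ?_⟩
    · obtain ⟨c, hc⟩ := ball_subset_cube u0 (5 * x) Ltqo (by linarith)
      exact ⟨c, fun v hv => hc v (pairBall hC hC' hx ha hb hu0 hv0 hd0 hv)⟩
    · intro d hd v hv hvX
      rcases hsynT d hd with ⟨hdS, hdc⟩ | ⟨hdS, hdc⟩
      · have := touchB hC hC' hx ha hb hu0 hv0 hd0 hdS hv hvX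
        rw [(hC.eqv a ha d this).1] at hdc
        exact hdc hna
      · have := touchB hC' hC hx hb ha hv0 hu0 (by rw [dd_comm]; exact hd0) hdS hv hvX.symm
        rw [(hC'.eqv b hb d this).1] at hdc
        exact hdc hnb
  -- isolated neutral clusters
  have iso : ∀ (S S' : Finset A) (cl cl' : A → Finset A) (q q' : A → Set (Site L D)),
      Clustering code Ltqo x S cl q → Clustering code Ltqo x S' cl' q' →
      suppIn (V + N + N') (ball x (hullS S q) ∪ ball x (hullS S' q')) →
      (∀ b, b ∈ code.syndrome (V + N + N') →
      (b ∈ S ∧ ¬ code.neutral Ltqo (cl b)) ∨ (b ∈ S' ∧ ¬ code.neutral Ltqo (cl' b))) →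
      ∀ a ∈ S, code.neutral Ltqo (cl a) → 
      (∀ u ∈ q a, ∀ w ∈ hullS S' q', 3 * x < dd u w) →
      (∃ c, ball x (q a) ⊆ cubeSet c Ltqo) ∧
        closedIn (V + N + N') (ball x (q a)) ∧
        ∀ d ∈ code.syndrome (V + N + N'), ∀ v ∈ elemCube (code.loc d), v ∉ ball x (q a) := by
    intro S S' cl cl' q q' hC hC' hs hsynT a ha hna hfar
    refine ⟨?_, closedA hC hx hs ha hfar, ?_⟩
    · obtain ⟨c, hc⟩ := ball_subset_cube (code.loc a) (2 * x) Ltqo (by linarith)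
      refine ⟨c, ?_⟩
      rintro v ⟨u, hu, hd⟩
      change dd u v ≤ x at hd
      apply hc
      have := dd_tri (code.loc a) u v
      have := hC.diam hx ha (hC.loc_mem ha) hu
      linarith
    · intro d hd v hv hvX
      rcases hsynT d hd with ⟨hdS, hdc⟩ | ⟨hdS, hdc⟩
      · have := hC.touch hx ha hdS hv hvX
        rw [(hC.eqv a ha d this).1] at hdc
        exact hdc hna
      · obtain ⟨u, hu, hd⟩ := hvX
        change dd u v ≤ x at hd
        have := hfar u hu v ⟨d, hdS, hC'.hull d hdS v hv⟩
        linarith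
  apply clean code h1 Y _ _ le_rfl
  intro p hp hpY
  rcases hs p hp with ⟨w, ⟨a, ha, hwa⟩, hdw⟩ | ⟨w, ⟨a, ha, hwa⟩, hdw⟩
  · have hpX : p.1 ∈ ball x (q a) := ⟨w, hwa, hdw⟩
    have hneu : code.neutral Ltqo (cl a) := by
      by_contra hcon
      exact hpY (hY a ha hcon hpX)
    by_cases hm : ∃ u ∈ q a, ∃ w ∈ hullS S' q', dd u w ≤ 3 * x
    · obtain ⟨u0, hu0, v0, ⟨b, hb, hv0⟩, hd0⟩ := hm
      have hnb := neutralB hC hC' hx hT hV hsyn ha hb hu0 hv0 hd0 hneu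
      exact ⟨_, Or.inl hpX, pair a ha b hb hneu hnb u0 hu0 v0 hv0 hd0⟩
    · push Not at hm
      exact ⟨_, hpX, iso S S' cl cl' q q' hC hC' hs hsynT a ha hneu hm⟩
  · have hpX : p.1 ∈ ball x (q' a) := ⟨w, hwa, hdw⟩
    have hneu : code.neutral Ltqo (cl' a) := by
      by_contra hcon
      exact hpY (hY' a ha hcon hpX)
    by_cases hm : ∃ u ∈ q' a, ∃ w ∈ hullS S q, dd u w ≤ 3 * x
    · obtain ⟨u0, hu0, v0, ⟨b, hb, hv0⟩, hd0⟩ := hm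
      have hnb := neutralB hC' hC hx hT hVsw hsynsw ha hb hu0 hv0 hd0 hneu
      exact ⟨_, Or.inr hpX, pair b hb a ha hnb hneu v0 hv0 u0 hu0 (by rw [dd_comm]; exact hd0)⟩
    · push Not at hm
      exact ⟨_, hpX, iso S' S cl' cl q' q hC' hC hssw (fun b hb => (hsynT b hb).symm)
        a ha hneu hm⟩

/-- An anchor of a charged cluster. -/
def Anchor (code : Code L D K A) (x α : ℝ) (S0 : Set (Site L D)) (C : Finset A)
    (Q : Set (Site L D)) : Prop :=
  ∃ (Z : Finset A) (z0 cz : Site L D) (f : Pauli (Site L D × Fin K)),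
    (∀ a ∈ Z, ∀ v ∈ elemCube (code.loc a), v ∈ cubeSet cz x) ∧ z0 ∈ cubeSet cz x ∧
    (∃ s ∈ S0, dd s z0 ≤ 3 * x) ∧
    (∀ a, a ∈ code.syndrome f ↔ ¬ (a ∈ C ↔ a ∈ Z)) ∧
    (∀ p, f p ≠ 0 → dd z0 p.1 ≤ 7 * (α * x)) ∧
    ∀ u ∈ Q, dd z0 u ≤ 2 * x + α * x

theorem Anchor.ball {α : ℝ} (hα : 1 ≤ α) (hx : 1 ≤ x) {S0 : Set (Site L D)} {C : Finset A}
    {Q : Set (Site L D)} (h : Anchor code x α S0 C Q) : ball x Q ⊆ ball (10 * α * x) S0 := by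
  obtain ⟨Z, z0, cz, f, _, _, ⟨s, hs, hsd⟩, _, _, hQ⟩ := h
  rintro v ⟨u, hu, hd⟩
  change dd u v ≤ x at hd
  refine ⟨s, hs, ?_⟩
  change dd s v ≤ _
  have := dd_tri s z0 v
  have := dd_tri z0 u v
  have := hQ u hu
  have : x ≤ α * x := by nlinarith
  nlinarith

theorem anchorBase (hC : Clustering code Ltqo x S cl q) {α : ℝ} (hα : 1 ≤ α) (hx : 1 ≤ x)
    {S0 : Set (Site L D)} {a : A} (ha : a ∈ S) {u s : Site L D} (hu : u ∈ q a) (hs : s ∈ S0)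
    (hd : dd u s ≤ 3 * x) : Anchor code x α S0 (cl a) (q a) := by
  obtain ⟨c, hc⟩ := hC.size a ha
  have hxx : x ≤ α * x := by nlinarith
  refine ⟨cl a, u, c, 0, fun b hb v hv => hc (hC.hull' ha hb v hv), hc hu,
    ⟨s, hs, by rw [dd_comm]; exact hd⟩, fun b => by rw [syn_zero]; simp,
    fun p hp => absurd rfl hp, fun v hv => ?_⟩
  have := hC.diam hx ha hu hv
  linarith

theorem anchorStep (hC : Clustering code Ltqo x S cl q) (hC' : Clustering code Ltqo x S' cl' q')
    {α : ℝ} (hα : 1 ≤ α)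
    (hx : 1 ≤ x) (hT : 40 * (α * x) ≤ Ltqo) (hL : 20 * (α * x) < L) (h2 : code.tqo2 Ltqo)
    (hns : code.noStrings Ltqo α)
    {V : Pauli (Site L D × Fin K)} (hV : suppIn V (BH.ball x (hullS S q) ∪ BH.ball x (hullS S' q')))
    (hsyn : ∀ a, a ∈ code.syndrome V ↔ ¬ (a ∈ S ↔ a ∈ S'))
    {a b : A} (ha : a ∈ S) (hb : b ∈ S') {u0 v0 : Site L D} (hu0 : u0 ∈ q a) (hv0 : v0 ∈ q' b)
    (hd0 : dd u0 v0 ≤ 3 * x) (hch : ¬ code.neutral Ltqo (cl' b)) {S0 : Set (Site L D)}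
    (hA : Anchor code x α S0 (cl a) (q a)) : Anchor code x α S0 (cl' b) (q' b) := by
  have hxx : x ≤ α * x := by nlinarith
  obtain ⟨Z, z0, cz, f, hZ, hz0, hs, hf, hfs, hQ⟩ := hA
  obtain ⟨c', hc'⟩ := hC'.size b hb
  set g := f + res V (BH.ball x (q a) ∪ BH.ball x (q' b)) with hg
  have hgsyn : ∀ d, d ∈ code.syndrome g ↔ ¬ (d ∈ cl' b ↔ d ∈ Z) := by
    intro d
    rw [hg, mem_syn_add, hf, synB hC hC' hx hV hsyn ha hb hu0 hv0 hd0]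
    tauto
  have hgs : smallSupp g Ltqo := by
    apply smallSupp_of_dd z0 (r := 8 * (α * x)) (by linarith)
    intro p hp
    by_cases hfp : f p = 0
    · have hr : res V (BH.ball x (q a) ∪ BH.ball x (q' b)) p ≠ 0 := by
        intro h0
        apply hp
        simp [hg, hfp, h0]
      have h5 := pairBall hC hC' hx ha hb hu0 hv0 hd0 (res_ne hr).1
      have := dd_tri z0 u0 p.1
      have := hQ u0 hu0
      linarith
    · have := hfs p hfp
      linarith
  have hgsites : ∀ v ∈ code.synSites (code.syndrome g), v ∈ cubeSet c' x ∨ v ∈ cubeSet cz x := by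
    intro v hv
    obtain ⟨d, hd, hvd⟩ := mem_synSites.1 hv
    rw [hgsyn] at hd
    by_cases hdb : d ∈ cl' b
    · exact Or.inl (hc' (hC'.hull' hb hdb v hvd))
    · have : d ∈ Z := by tauto
      exact Or.inr (hZ d this v hvd)
  -- the two cubes are close
  have hclose : ∃ u ∈ cubeSet c' x, ∃ v ∈ cubeSet cz x, dd u v < α * x := by
    by_contra hcon
    push Not at hcon
    have hdisj : Disjoint (cubeSet c' x) (cubeSet cz x) := by
      rw [Set.disjoint_left]
      intro u hu hu'
      have := hcon u hu u hu'
      rw [dd_self] at this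
      linarith
    have := (hns g x c' cz (by linarith) hgs hdisj hcon hgsites).1
    apply hch
    convert this using 1
    ext d
    simp only [Code.partIn, Finset.mem_filter]
    rw [hgsyn]
    have hl := loc_mem_elemCube (code.loc d)
    have i1 : d ∈ cl' b → ∀ v ∈ elemCube (code.loc d), v ∈ cubeSet c' x :=
      fun hdb v hv => hc' (hC'.hull' hb hdb v hv)
    have i2 : d ∈ Z → ¬ ∀ v ∈ elemCube (code.loc d), v ∈ cubeSet c' x :=
      fun hdZ h => Set.disjoint_left.1 hdisj (h _ hl) (hZ d hdZ _ hl)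
    constructor
    · intro h
      exact ⟨fun hh => i2 (hh.1 h) (i1 h), i1 h⟩
    · rintro ⟨h, h'⟩
      by_contra h3
      exact h (iff_of_false h3 fun h4 => i2 h4 h')
  obtain ⟨u, hu, v, hv, huv⟩ := hclose
  have hcross : ∀ w ∈ cubeSet c' x, ∀ z ∈ cubeSet cz x, dd z w ≤ 2 * x + α * x := by
    intro w hw z hz
    have := dd_tri z v w
    have := dd_tri v u w
    have := dd_le_of_cubeSet (by linarith) hu hw
    have := dd_le_of_cubeSet (by linarith) hz hv
    rw [dd_comm u v] at huv
    linarith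
  have hz0g : ∀ s ∈ code.synSites (code.syndrome g), dd z0 s ≤ 2 * x + α * x := by
    intro s hs
    rcases hgsites s hs with h | h
    · exact hcross s h z0 hz0
    · have := dd_le_of_cubeSet (by linarith) hz0 h
      linarith
  have hfnew : ∃ f', code.syndrome f' = code.syndrome g ∧
      ∀ p, f' p ≠ 0 → dd z0 p.1 ≤ 7 * (α * x) := by
    by_cases hne : (code.synSites (code.syndrome g)).Nonempty
    · obtain ⟨s, hs⟩ := hne
      obtain ⟨f', hf', hfs'⟩ := tqo2_local code h2 (W := code.syndrome g) ⟨g, rfl, hgs⟩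
        (r := 2 * x + α * x) (by linarith) (by linarith) (by
          intro s hs t ht
          rcases hgsites s hs with h | h <;> rcases hgsites t ht with h' | h'
          · have := dd_le_of_cubeSet (by linarith) h h'
            linarith
          · rw [dd_comm]; exact hcross s h t h'
          · exact hcross t h' s h
          · have := dd_le_of_cubeSet (by linarith) h h'
            linarith) hs
      refine ⟨f', hf', fun p hp => ?_⟩
      have := hfs' p hp
      have := hz0g s hs
      have := dd_tri z0 s p.1
      linarith
    · refine ⟨0, ?_, fun p hp => absurd rfl hp⟩
      rw [syn_zero]
      symm
      rw [Finset.eq_empty_iff_forall_notMem]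
      intro d hd
      exact hne ⟨_, Finset.mem_coe.1 (mem_synSites.2 ⟨d, hd, loc_mem_elemCube _⟩)⟩
  obtain ⟨f', hf', hfs'⟩ := hfnew
  exact ⟨Z, z0, cz, f', hZ, hz0, hs, fun d => by rw [hf', hgsyn], hfs',
    fun w hw => hcross w (hc' hw) z0 hz0⟩

end

/-! ### From sparseness to clusterings -/

theorem dd_le_fdiam {X : Finset (Site L D)} {u v : Site L D} (hu : u ∈ X) (hv : v ∈ X) :
    dd u v ≤ (fdiam X : ℝ) := by
  unfold dd fdiam
  have h1 : dist' u v ≤ X.sup fun v => dist' u v := Finset.le_sup (f := fun v => dist' u v) hv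
  have h2 : (X.sup fun v => dist' u v) ≤ X.sup fun u => X.sup fun v => dist' u v :=
    Finset.le_sup (f := fun u => X.sup fun v => dist' u v) hu
  exact_mod_cast h1.trans h2

theorem exists_of_lt_fdiam {X : Finset (Site L D)} {r : ℝ} (hr : 0 ≤ r) (h : r < (fdiam X : ℝ)) :
    ∃ u ∈ X, ∃ v ∈ X, r < dd u v := by
  by_contra hcon
  push Not at hcon
  have : fdiam X ≤ ⌊r⌋₊ := by
    unfold fdiam
    apply Finset.sup_le
    intro u hu
    apply Finset.sup_le
    intro v hv
    exact Nat.le_floor (hcon u hu v hv)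
  have := (Nat.le_floor_iff hr).1 this
  linarith

theorem exists_clustering (code : Code L D K A) {Ltqo α : ℝ} (hα : 1 ≤ α) (n : ℕ)
    (h2 : code.tqo2 Ltqo) (hx : 1 ≤ ξ α n) (hL : 3 * ξ α n < L) (S : Finset A)
    (hsp : sparseAt α n (code.synCubes S)) :
    ∃ cl q, Clustering code Ltqo (ξ α n) S cl q := by
  classical
  obtain ⟨P, _, hsub, huniq, hdiam, hsep⟩ := hsp
  choose c ℓ hmin using fun C : Finset A =>
    exists_minEnclosing (code.synSites C : Set (Site L D))
  set x := ξ α n with hxdef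
  have hnext : 10 * x ≤ ξ α (n + 1) := by
    have : ξ α (n + 1) = x * (10 * α) := by rw [hxdef]; unfold ξ; rw [pow_succ]
    rw [this]; nlinarith
  let cl : A → Finset A := fun a => S.filter fun b => ∃ C ∈ P, code.loc a ∈ C ∧ code.loc b ∈ C
  have hcl : ∀ a b, b ∈ cl a ↔ b ∈ S ∧ ∃ C ∈ P, code.loc a ∈ C ∧ code.loc b ∈ C := by
    intro a b; simp [cl]
  have hS : ∀ a ∈ S, code.loc a ∈ code.synCubes S := fun a ha => Finset.mem_image_of_mem _ ha
  have hex : ∀ a ∈ S, ∃ C ∈ P, code.loc a ∈ C ∧ ∀ C' ∈ P, code.loc a ∈ C' → C' = C := by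
    intro a ha
    obtain ⟨C, ⟨h1, h2⟩, h3⟩ := huniq _ (hS a ha)
    exact ⟨C, h1, h2, fun C' h4 h5 => h3 C' ⟨h4, h5⟩⟩
  have hmem : ∀ a ∈ S, a ∈ cl a := by
    intro a ha
    obtain ⟨C, h1, h2, _⟩ := hex a ha
    exact (hcl a a).2 ⟨ha, C, h1, h2, h2⟩
  have hclsub : ∀ a, cl a ⊆ S := fun a => Finset.filter_subset _ _
  have heqv : ∀ a ∈ S, ∀ b ∈ cl a, cl b = cl a := by
    intro a ha b hb
    obtain ⟨hbS, C, hC, haC, hbC⟩ := (hcl a b).1 hb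
    obtain ⟨Ca, _, _, hCa⟩ := hex a ha
    obtain ⟨Cb, _, _, hCb⟩ := hex b hbS
    ext d
    rw [hcl, hcl]
    constructor
    · rintro ⟨hd, C', hC', h3, h4⟩
      refine ⟨hd, C, hC, haC, ?_⟩
      rw [hCb C hC hbC, ← hCb C' hC' h3]; exact h4
    · rintro ⟨hd, C', hC', h3, h4⟩
      refine ⟨hd, C, hC, hbC, ?_⟩
      rw [hCa C hC haC, ← hCa C' hC' h3]; exact h4
  have hd : ∀ a ∈ S, ∀ u ∈ code.synSites (cl a), ∀ v ∈ code.synSites (cl a), dd u v ≤ x := by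
    intro a ha u hu v hv
    obtain ⟨C, hC, haC, hCu⟩ := hex a ha
    have key : ∀ w ∈ code.synSites (cl a), w ∈ C.biUnion elemCube := by
      intro w hw
      obtain ⟨e, he, hwe⟩ := mem_synSites.1 hw
      obtain ⟨_, C', hC', h3, h4⟩ := (hcl a e).1 he
      rw [hCu C' hC' h3] at h4
      exact Finset.mem_biUnion.2 ⟨_, h4, hwe⟩
    exact (dd_le_fdiam (key u hu) (key v hv)).trans (hdiam C hC)
  have hne : ∀ a ∈ S, code.loc a ∈ code.synSites (cl a) := fun a ha =>
    Finset.mem_coe.1 (mem_synSites.2 ⟨a, hmem a ha, loc_mem_elemCube _⟩)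
  have hsize : ∀ a ∈ S, ℓ (cl a) ≤ x := by
    intro a ha
    obtain ⟨c', hc'⟩ := cube_hull _ ⟨_, hne a ha⟩ x (by linarith) hL (hd a ha)
    exact (hmin (cl a)).2.2 c' x (by linarith) fun v hv => hc' v hv
  refine ⟨cl, fun a => cubeSet (c (cl a)) (ℓ (cl a)), ⟨hmem, fun a _ => hclsub a, ?_, ?_, ?_, ?_,
    ?_⟩⟩
  · intro a ha b hb
    have := heqv a ha b hb
    exact ⟨this, by simp only [this]⟩
  · intro a ha v hv
    exact (hmin (cl a)).2.1 (mem_synSites.2 ⟨a, hmem a ha, hv⟩)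
  · intro a ha
    exact ⟨c (cl a), fun v hv i => (hv i).trans (hsize a ha)⟩
  · intro a ha hn
    exact h2 (cl a) hn _ _ (hmin (cl a))
  · intro a ha b hb hba u hu v hv
    obtain ⟨Ca, hCa, haCa, hCau⟩ := hex a ha
    obtain ⟨Cb, hCb, hbCb, hCbu⟩ := hex b hb
    have hneq : Ca ≠ Cb := by
      rintro rfl
      exact hba ((hcl a b).2 ⟨hb, Ca, hCa, haCa, hbCb⟩)
    obtain ⟨s, hs, t, ht, hst⟩ := exists_of_lt_fdiam (by linarith) (hsep Ca hCa Cb hCb hneq)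
    have key : ∀ w ∈ (Ca ∪ Cb).biUnion elemCube,
        w ∈ cubeSet (c (cl a)) (ℓ (cl a)) ∨ w ∈ cubeSet (c (cl b)) (ℓ (cl b)) := by
      intro w hw
      obtain ⟨y, hy, hwy⟩ := Finset.mem_biUnion.1 hw
      rcases Finset.mem_union.1 hy with hy | hy
      · left
        obtain ⟨e, he, rfl⟩ := Finset.mem_image.1 (hsub Ca hCa hy)
        exact (hmin (cl a)).2.1 (mem_synSites.2 ⟨e, (hcl a e).2 ⟨he, Ca, hCa, haCa, hy⟩, hwy⟩)
      · right
        obtain ⟨e, he, rfl⟩ := Finset.mem_image.1 (hsub Cb hCb hy)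
        exact (hmin (cl b)).2.1 (mem_synSites.2 ⟨e, (hcl b e).2 ⟨he, Cb, hCb, hbCb, hy⟩, hwy⟩)
    have da : ∀ w ∈ cubeSet (c (cl a)) (ℓ (cl a)), ∀ w' ∈ cubeSet (c (cl a)) (ℓ (cl a)),
        dd w w' ≤ x := fun w hw w' hw' =>
      (dd_le_of_cubeSet (hmin (cl a)).1 hw hw').trans (hsize a ha)
    have db : ∀ w ∈ cubeSet (c (cl b)) (ℓ (cl b)), ∀ w' ∈ cubeSet (c (cl b)) (ℓ (cl b)),
        dd w w' ≤ x := fun w hw w' hw' =>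
      (dd_le_of_cubeSet (hmin (cl b)).1 hw hw').trans (hsize b hb)
    rcases key s hs with h | h <;> rcases key t ht with h' | h'
    · have := da s h t h'
      linarith
    · have := da s h u hu
      have := db v hv t h'
      have := dd_tri s u t
      have := dd_tri u v t
      linarith
    · have := da t h' u hu
      have := db v hv s h
      have := dd_tri t u s
      have := dd_tri u v s
      rw [dd_comm] at hst
      linarith
    · have := db s h t h'
      linarith

/-! ### Core induction along the path -/

theorem exists_prev (Mem : ℕ → Prop) (t' s : ℕ) (h : t' < s) (hM : Mem t') :
    ∃ s0, t' ≤ s0 ∧ s0 < s ∧ Mem s0 ∧ ∀ r, s0 < r → r < s → ¬ Mem r := by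
  classical
  have h1 : t' ≤ s - 1 := by omega
  refine ⟨Nat.findGreatest Mem (s - 1), Nat.le_findGreatest h1 hM, ?_,
    Nat.findGreatest_spec h1 hM, fun r hr hrs => ?_⟩
  · have := Nat.findGreatest_le (P := Mem) (s - 1)
    omega
  · exact Nat.findGreatest_is_greatest hr (by omega)

theorem core (code : Code L D K A) {Ltqo α : ℝ} (hα : 1 ≤ α) (n : ℕ)
    (h1 : code.tqo1 Ltqo) (h2 : code.tqo2 Ltqo) (hns : code.noStrings Ltqo α)
    (hx : 1 ≤ ξ α n) (hT : 40 * (α * ξ α n) ≤ Ltqo) (hL : 20 * (α * ξ α n) < L)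
    (Pa : ℕ → Pauli (Site L D × Fin K)) (t' t'' : ℕ) (hlt : t' < t'') (Mem : ℕ → Prop)
    (hM' : Mem t') (hM'' : Mem t'')
    (hsp : ∀ s, t' < s → s < t'' → Mem s → sparseAt α n (code.synCubes (code.syndrome (Pa s))))
    (hIH : ∀ s s', t' ≤ s → s < s' → s' ≤ t'' → Mem s → Mem s' →
      (∀ r, s < r → r < s' → ¬ Mem r) →
      inM code (ball (ξ α n) ((code.synSites (code.syndrome (Pa s)) : Set (Site L D)) ∪
        (code.synSites (code.syndrome (Pa s')) : Set (Site L D)))) (Pa s' - Pa s)) :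
    inM code (ball (10 * α * ξ α n)
      ((code.synSites (code.syndrome (Pa t')) : Set (Site L D)) ∪
        (code.synSites (code.syndrome (Pa t'')) : Set (Site L D)))) (Pa t'' - Pa t') := by
  set x := ξ α n with hxdef
  have hxx : x ≤ α * x := by nlinarith
  have hT' : 40 * x ≤ Ltqo := by linarith
  set S0 := code.syndrome (Pa t') with hS0
  set Y : Set (Site L D) := ball (10 * α * x) (code.synSites S0 : Set (Site L D)) with hYdef
  have ballunion : ∀ (r : ℝ) (X X' : Set (Site L D)), ball r (X ∪ X') ⊆ ball r X ∪ ball r X' := by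
    rintro r X X' v ⟨u, hu | hu, hd⟩
    · exact Or.inl ⟨u, hu, hd⟩
    · exact Or.inr ⟨u, hu, hd⟩
  -- syndromes of local replacements
  have hsynE : ∀ s s' H, (Pa s' - Pa s) + H ∈ code.stab → ∀ a, a ∈ code.syndrome H ↔
      ¬ (a ∈ code.syndrome (Pa s) ↔ a ∈ code.syndrome (Pa s')) := by
    intro s s' H h a
    rw [← syn_eq_of_stab code h, pauli_sub, mem_syn_add]
    tauto
  have inv : ∀ s, t' < s → s < t'' → Mem s → ∃ cl q N,
      Clustering code Ltqo x (code.syndrome (Pa s)) cl q ∧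
      (∀ a, a ∈ code.syndrome N ↔ a ∈ code.syndrome (Pa s) ∧ code.neutral Ltqo (cl a)) ∧
      suppIn N (ball x (hullS (code.syndrome (Pa s)) q)) ∧
      inM code Y ((Pa s - Pa t') + N) ∧
      ∀ a ∈ code.syndrome (Pa s), ¬ code.neutral Ltqo (cl a) →
        Anchor code x α (code.synSites S0 : Set (Site L D)) (cl a) (q a) := by
    intro s
    induction s using Nat.strong_induction_on with
    | _ s ih =>
    intro hs hs' hMs
    obtain ⟨cl', q', hC'⟩ := exists_clustering code hα n h2 hx (by linarith) _ (hsp s hs hs' hMs)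
    obtain ⟨N', hN', hNs'⟩ := exists_neutralOp hC' hx
    obtain ⟨s0, hs0, hs0s, hMs0, hbetw⟩ := exists_prev Mem t' s hs hM'
    obtain ⟨H, hHs, hHst⟩ := hIH s0 s hs0 hs0s hs'.le hMs0 hMs hbetw
    have hsynH := hsynE s0 s H hHst
    refine ⟨cl', q', N', hC', hN', hNs', ?_⟩
    rcases eq_or_lt_of_le hs0 with heq | hlt0
    · -- base case
      subst heq
      have hsynH' : ∀ a, a ∈ code.syndrome H ↔ ¬ (a ∈ code.syndrome (Pa s) ↔ a ∈ S0) := by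
        intro a; exact (hsynH a).trans (not_congr iff_comm)
      have hHs' : suppIn H (ball x (hullS (code.syndrome (Pa s)) q') ∪
          ball x (code.synSites S0 : Set (Site L D))) := by
        refine suppIn_mono ?_ hHs
        refine (ballunion _ _ _).trans ?_
        rw [Set.union_comm]
        exact Set.union_subset_union_left _ (ball_mono le_rfl hC'.sites_sub)
      have hanch : ∀ a ∈ code.syndrome (Pa s), ¬ code.neutral Ltqo (cl' a) →
          Anchor code x α (code.synSites S0 : Set (Site L D)) (cl' a) (q' a) := by
        intro a ha hch
        obtain ⟨u, hu, w, hw, hd⟩ := chargedNear hC' hx hT' subset_rfl hHs' hsynH' ha hch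
        exact anchorBase hC' hα hx ha hu hw hd
      refine ⟨?_, hanch⟩
      have hM := endLemma hC' hx hT' h1 hHs' hsynH' hN' hNs' (Y := Y)
        (ball_mono (by nlinarith) subset_rfl) (fun a ha hch => (hanch a ha hch).ball hα hx)
      have := inM_add code (inM_of_stab code hHst (Y := Y)) hM
      have e : Pa s - Pa t' + H + (H + N') = Pa s - Pa t' + N' := by
        rw [add_assoc, ← add_assoc H H N', pauli_add_self, zero_add]
      rwa [e] at this
    · -- induction step
      obtain ⟨cl, q, N, hC, hN, hNs, hM, hanch⟩ := ih s0 hs0s hlt0 (hs0s.trans hs') hMs0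
      have hHs' : suppIn H (ball x (hullS (code.syndrome (Pa s0)) q) ∪
          ball x (hullS (code.syndrome (Pa s)) q')) := by
        refine suppIn_mono ?_ hHs
        refine (ballunion _ _ _).trans ?_
        exact Set.union_subset_union (ball_mono le_rfl hC.sites_sub)
          (ball_mono le_rfl hC'.sites_sub)
      have hHsw : suppIn H (ball x (hullS (code.syndrome (Pa s)) q') ∪
          ball x (hullS (code.syndrome (Pa s0)) q)) := by
        rw [Set.union_comm]; exact hHs'
      have hsynsw : ∀ a, a ∈ code.syndrome H ↔
          ¬ (a ∈ code.syndrome (Pa s) ↔ a ∈ code.syndrome (Pa s0)) := by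
        intro a; exact (hsynH a).trans (not_congr iff_comm)
      have hanch' : ∀ a ∈ code.syndrome (Pa s), ¬ code.neutral Ltqo (cl' a) →
          Anchor code x α (code.synSites S0 : Set (Site L D)) (cl' a) (q' a) := by
        intro b hb hch
        obtain ⟨v0, hv0, u0, ⟨a, ha, hu0⟩, hd⟩ :=
          chargedNear hC' hx hT' hC.sites_sub hHsw hsynsw hb hch
        rw [dd_comm] at hd
        have hcha : ¬ code.neutral Ltqo (cl a) := fun hna =>
          hch (neutralB hC hC' hx hT' hHs' hsynH ha hb hu0 hv0 hd hna)
        exact anchorStep hC hC' hα hx hT hL h2 hns hHs' hsynH ha hb hu0 hv0 hd hch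
          (hanch a ha hcha)
      refine ⟨?_, hanch'⟩
      have hM2 := stepLemma hC hC' hx hT' h1 hHs' hsynH hN hNs hN' hNs' (Y := Y)
        (fun a ha hch => (hanch a ha hch).ball hα hx)
        (fun a ha hch => (hanch' a ha hch).ball hα hx)
      have := inM_add code (inM_add code (inM_of_stab code hHst (Y := Y)) hM) hM2
      have e : Pa s - Pa s0 + H + (Pa s0 - Pa t' + N) + (H + N + N') =
          Pa s - Pa t' + N' + (H + H) + (N + N) := by abel
      rw [e, pauli_add_self, pauli_add_self, add_zero, add_zero] at this
      exact this
  -- final step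
  obtain ⟨s0, hs0, hs0s, hMs0, hbetw⟩ := exists_prev Mem t' t'' hlt hM'
  have hfin := hIH s0 t'' hs0 hs0s le_rfl hMs0 hM'' hbetw
  rcases eq_or_lt_of_le hs0 with heq | hlt0
  · subst heq
    exact inM_mono code (ball_mono (by nlinarith) subset_rfl) hfin
  obtain ⟨H, hHs, hHst⟩ := hfin
  have hsynH := hsynE s0 t'' H hHst
  obtain ⟨cl, q, N, hC, hN, hNs, hM, hanch⟩ := inv s0 hlt0 hs0s hMs0
  have hHs' : suppIn H (ball x (hullS (code.syndrome (Pa s0)) q) ∪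
      ball x (code.synSites (code.syndrome (Pa t'')) : Set (Site L D))) := by
    refine suppIn_mono ?_ hHs
    refine (ballunion _ _ _).trans ?_
    exact Set.union_subset_union_left _ (ball_mono le_rfl hC.sites_sub)
  have hM2 := endLemma hC hx hT' h1 hHs' hsynH hN hNs
    (Y := ball (10 * α * x) ((code.synSites S0 : Set (Site L D)) ∪
        (code.synSites (code.syndrome (Pa t'')) : Set (Site L D))))
    (ball_mono (by nlinarith) Set.subset_union_right)
    (fun a ha hch => ((hanch a ha hch).ball hα hx).trans
      (ball_mono le_rfl Set.subset_union_left))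
  have := inM_add code (inM_add code (inM_of_stab code hHst)
    (inM_mono code (ball_mono le_rfl Set.subset_union_left) hM)) hM2
  have e : Pa t'' - Pa s0 + H + (Pa s0 - Pa t' + N) + (H + N) =
      Pa t'' - Pa t' + (H + H) + (N + N) := by abel
  rw [e, pauli_add_self, pauli_add_self, add_zero, add_zero] at this
  exact this

theorem one_le_xi {α : ℝ} (hα : 1 ≤ α) (n : ℕ) : 1 ≤ ξ α n :=
  one_le_pow₀ (by linarith)

theorem partialSum_succ {Q : Type} {T : ℕ} (Ep : Fin T → Pauli Q) (t : ℕ) (ht : t < T) :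
    partialSum Ep (t + 1) - partialSum Ep t = Ep ⟨t, ht⟩ := by
  unfold partialSum
  rw [← Finset.sum_sub_distrib, Finset.sum_eq_single ⟨t, ht⟩]
  · simp
  · intro s _ hs
    have : (s : ℕ) ≠ t := fun h => hs (Fin.ext h)
    by_cases h : (s : ℕ) < t
    · rw [if_pos h, if_pos (by omega), sub_self]
    · rw [if_neg h, if_neg (by omega), sub_self]
  · simp

theorem single_small {E : Pauli (Site L D × Fin K)} (h : singleQubit E) {ℓ : ℝ} (hℓ : 0 ≤ ℓ) :
    smallSupp E ℓ := by
  obtain ⟨p, hp⟩ := h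
  refine ⟨p.1, fun p' hp' => ?_⟩
  rw [hp p' hp']
  intro i
  simpa using hℓ

theorem main_aux (code : Code L D K A) (Ltqo α : ℝ) (hα : 1 ≤ α)
    (htqo : code.tqo Ltqo) (hns : code.noStrings Ltqo α)
    (T : ℕ) (Ep : Fin T → Pauli (Site L D × Fin K))
    (hsq : ∀ t, singleQubit (Ep t))
    (m : ℕ) (hm : ∀ t ≤ T, (code.syndrome (partialSum Ep t)).card ≤ m)
    (p : ℕ) : 4 * (m : ℝ) * (2 + ξ α p) < Ltqo → 
    ∀ (t' t'' : ℕ), levelMember code α Ep p t' → levelMember code α Ep p t'' →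
    t' < t'' → (∀ s, t' < s → s < t'' → ¬ levelMember code α Ep p s) →
    inM code (ball (ξ α p)
        ((code.synSites (code.syndrome (partialSum Ep t')) : Set (Site L D)) ∪
          (code.synSites (code.syndrome (partialSum Ep t'')) : Set (Site L D))))
      (partialSum Ep t'' - partialSum Ep t') := by
  have hsub : ∀ s s' a, a ∈ code.syndrome (partialSum Ep s' - partialSum Ep s) ↔
      ¬ (a ∈ code.syndrome (partialSum Ep s) ↔ a ∈ code.syndrome (partialSum Ep s')) := by
    intro s s' a
    rw [pauli_sub, mem_syn_add]; exact not_congr iff_comm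
  induction p with
  | zero =>
    intro hscale t' t'' ht' ht'' hlt hcon
    have hLt : 0 ≤ Ltqo := by
      have := one_le_xi hα 0
      have : 0 ≤ 4 * (m : ℝ) * (2 + ξ α 0) := by positivity
      linarith
    have hmem : ∀ s ≤ T, levelMember code α Ep 0 s := fun s hs =>
      ⟨hs, Or.inr (Or.inr fun q hq => absurd hq (Nat.not_lt_zero q))⟩
    have hT'' := ht''.1
    have heq : t'' = t' + 1 := by
      by_contra hne
      exact hcon (t' + 1) (by omega) (by omega) (hmem _ (by omega))
    subst heq
    have hE := partialSum_succ Ep t' (by omega)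
    have hs := hsub t' (t' + 1)
    rw [hE] at hs ⊢
    set E := Ep ⟨t', by omega⟩ with hEdef
    by_cases hemp : code.syndrome E = ∅
    · exact inM_of_stab code (htqo.1 _ (single_small (hsq _) hLt) hemp)
    · obtain ⟨a, ha⟩ := Finset.nonempty_iff_ne_empty.2 hemp
      obtain ⟨q, hq, hqa⟩ := syn_touch code ha
      obtain ⟨q0, hq0⟩ := hsq ⟨t', by omega⟩
      apply inM_of_supp
      intro q' hq'
      have : q' = q := by rw [hq0 q' hq', hq0 q hq]
      rw [this]
      apply ball_self (by have := one_le_xi hα 0; linarith)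
      rw [hs] at ha
      by_cases h3 : a ∈ code.syndrome (partialSum Ep t')
      · exact Or.inl (mem_synSites.2 ⟨a, h3, hqa⟩)
      · have h4 : a ∈ code.syndrome (partialSum Ep (t' + 1)) := by
          by_contra h5
          exact ha (iff_of_false h3 h5)
        exact Or.inr (mem_synSites.2 ⟨a, h4, hqa⟩)
  | succ n ih =>
    intro hscale t' t'' ht' ht'' hlt hcon
    have hx := one_le_xi hα n
    have hnext : ξ α (n + 1) = 10 * α * ξ α n := by unfold ξ; rw [pow_succ]; ring
    have hxx : ξ α n ≤ α * ξ α n := by nlinarith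
    have hm0 : (0 : ℝ) ≤ m := by positivity
    have hscale' : 4 * (m : ℝ) * (2 + ξ α n) < Ltqo := by
      refine lt_of_le_of_lt ?_ hscale
      apply mul_le_mul_of_nonneg_left _ (by positivity)
      rw [hnext]; nlinarith
    have hLt : 0 ≤ Ltqo := by
      have : 0 ≤ 4 * (m : ℝ) * (2 + ξ α n) := by positivity
      linarith
    rcases Nat.eq_zero_or_pos m with hm00 | hmpos
    · -- no defects at all
      have hemp : ∀ t ≤ T, code.syndrome (partialSum Ep t) = ∅ := fun t ht =>
        Finset.card_eq_zero.1 (by have := hm t ht; omega)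
      apply inM_of_stab
      have key : ∀ t ≤ T, partialSum Ep t ∈ code.stab := by
        intro t
        induction t with
        | zero =>
          intro _
          have : partialSum Ep 0 = 0 := by simp [partialSum]
          rw [this]; exact code.stab.zero_mem
        | succ t iht =>
          intro ht
          have h3 := partialSum_succ Ep t (by omega)
          have h4 : Ep ⟨t, by omega⟩ ∈ code.stab := by
            apply htqo.1 _ (single_small (hsq _) hLt)
            rw [← h3]
            ext a
            rw [hsub, hemp t (by omega), hemp (t + 1) ht]
            simp
          have h5 := code.stab.add_mem h4 (iht (by omega))
          rw [← h3, sub_add_cancel] at h5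
          exact h5
      exact code.stab.sub_mem (key _ ht''.1) (key _ ht'.1)
    have hm1 : (1 : ℝ) ≤ m := by exact_mod_cast hmpos
    have hbig : 4 * (2 + ξ α (n + 1)) ≤ Ltqo := by
      have h0 := one_le_xi hα (n + 1)
      nlinarith
    by_cases hLcase : 2 * ξ α (n + 1) < L
    · rw [hnext]
      rw [hnext] at hLcase hbig
      apply core code hα n htqo.1 htqo.2 hns hx (by nlinarith) (by nlinarith) _ _ _ hlt
        (levelMember code α Ep n)
      · exact ⟨ht'.1, ht'.2.imp_right (Or.imp_right fun h q hq => h q (by omega))⟩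
      · exact ⟨ht''.1, ht''.2.imp_right (Or.imp_right fun h q hq => h q (by omega))⟩
      · intro s hs hs' hMs
        by_contra hns
        apply hcon s hs hs'
        refine ⟨hMs.1, Or.inr (Or.inr ?_)⟩
        have h0 : s ≠ 0 := by omega
        have hTT : s ≠ T := by have := ht''.1; omega
        have hd := (hMs.2.resolve_left h0).resolve_left hTT
        intro q hq
        rcases Nat.lt_succ_iff_lt_or_eq.1 hq with h | h
        · exact hd q h
        · subst h
          refine ⟨?_, hns⟩
          by_contra hne
          rw [Finset.not_nonempty_iff_eq_empty] at hne
          apply hns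
          refine ⟨∅, ?_⟩
          rw [hne]
          simp [clusterPartition]
      · intro s s' _ hss' _ hMs hMs' hb
        exact ih hscale' s s' hMs hMs' hss' hb
    · push Not at hLcase
      by_cases hne : ((code.synSites (code.syndrome (partialSum Ep t')) : Set (Site L D)) ∪
          (code.synSites (code.syndrome (partialSum Ep t'')) : Set (Site L D))).Nonempty
      · obtain ⟨u, hu⟩ := hne
        apply inM_of_supp
        intro q _
        refine ⟨u, hu, ?_⟩
        change dd u q.1 ≤ _
        have := dd_half u q.1
        linarith
      · apply inM_of_stab
        apply htqo.1
        · refine ⟨0, fun q _ i => ?_⟩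
          have : (((q.1 i - (0 : Site L D) i).val : ℕ) : ℝ) ≤ L := by
            exact_mod_cast (ZMod.val_lt _).le
          have := one_le_xi hα (n + 1)
          linarith
        · rw [Finset.eq_empty_iff_forall_notMem]
          intro a ha
          rw [hsub] at ha
          apply hne
          by_cases h3 : a ∈ code.syndrome (partialSum Ep t')
          · exact ⟨_, Or.inl (mem_synSites.2 ⟨a, h3, loc_mem_elemCube _⟩)⟩
          · have h4 : a ∈ code.syndrome (partialSum Ep t'') := by
              by_contra h5
              exact ha (iff_of_false h3 h5)
            exact ⟨_, Or.inr (mem_synSites.2 ⟨a, h4, loc_mem_elemCube _⟩)⟩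

/-- Lemma 2 of Bravyi–Haah. For a local stabilizer code with
the topological order conditions and the no-strings rule, given an error path
with maximal syndrome weight `m` and a level `p` with `4m(2 + ξ(p)) < Ltqo`:
for every consecutive pair `S′ = S(t′)`, `S″ = S(t″)` of the level-`p`
syndrome history, the level-`p` error `E` connecting them admits a Pauli
operator `Ẽ` supported on `B_{ξ(p)}(S′ ∪ S″)` such that `E·Ẽ` is a
stabilizer. -/
theorem level_p_errors_localizable
    (L D K : ℕ) [NeZero L] (A : Type) [Fintype A]
    (code : Code L D K A) (Ltqo α : ℝ) (hα : 1 ≤ α)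
    (htqo : code.tqo Ltqo) (hns : code.noStrings Ltqo α)
    (T : ℕ) (Ep : Fin T → Pauli (Site L D × Fin K))
    (hsq : ∀ t, singleQubit (Ep t))
    (m : ℕ) (hm : ∀ t ≤ T, (code.syndrome (partialSum Ep t)).card ≤ m)
    (p : ℕ) (hscale : 4 * (m : ℝ) * (2 + ξ α p) < Ltqo)
    (t' t'' : ℕ) (ht' : levelMember code α Ep p t') (ht'' : levelMember code α Ep p t'')
    (hlt : t' < t'')
    (hconsec : ∀ s, t' < s → s < t'' → ¬ levelMember code α Ep p s) :
    ∃ Etil : Pauli (Site L D × Fin K),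
      suppIn Etil (ball (ξ α p)
        ((code.synSites (code.syndrome (partialSum Ep t')) ∪
          code.synSites (code.syndrome (partialSum Ep t''))) : Set (Site L D))) ∧
      (partialSum Ep t'' - partialSum Ep t') + Etil ∈ code.stab := by
  exact main_aux code Ltqo α hα htqo hns T Ep hsq m hm p hscale t' t'' ht' ht'' hlt hconsec

end BH
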